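/- arXiv:2404.03933 — 3 statements merged into one kernel-verified Lean document; each statement's English description precedes it below -/
import Mathlib

section
/- Fix an odd integer l ≥ 3, s ∈ ℕ, and θ > 0. For N ∈ ℕ with N > max(2s, θ) set x_N := √(N/θ) (so that x_N = e^{t_N} with N e^{−2t_N} = θ). Then lim_{N→∞} M^{(l)}_{N−2s}(N) · ch_{T(N−2s)}(x_N) / (x_N + x_N^{−1})^{N} = θ^{s} e^{−θ} / s!. -/
/-- `intBinom N j = binom(N, j)` for an integer `j`, with the convention that it vanishes
for `j < 0` or `j > N`. -/
def intBinom (N : ℕ) (j : ℤ) : ℤ :=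
  if 0 ≤ j ∧ j ≤ (N : ℤ) then (N.choose j.toNat : ℤ) else 0

/-- `Fcoef N k = F^{(N)}_k = binom(N,(N−k)/2) − binom(N,(N−k−2)/2)` if `k ≡ N (mod 2)`,
and `0` otherwise. -/
def Fcoef (N : ℕ) (k : ℤ) : ℤ :=
  if ((N : ℤ) - k) % 2 = 0 then
    intBinom N (((N : ℤ) - k) / 2) - intBinom N (((N : ℤ) - k - 2) / 2)
  else 0

/-- The multiplicity `M^{(l)}_k(N)` of the tilting module `T(k)` in `T(1)^{⊗N}`.
Writing `k = k₁ l + k₀` with `0 ≤ k₀ ≤ l−1`, it is `F^{(N)}_k` when `k₀ = l−1`, and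
`Σ_{j≥0} (F^{(N)}_{k+2jl} − F^{(N)}_{(k₁+2j+2)l−k₀−2})` when `0 ≤ k₀ ≤ l−2`; all terms of the
infinite sum with `j > N` vanish, so it is truncated at `j = N`. -/
def Mmult (l k N : ℕ) : ℤ :=
  if k % l = l - 1 then Fcoef N k
  else ∑ j ∈ Finset.range (N + 1),
    (Fcoef N ((k : ℤ) + 2 * j * l) -
      Fcoef N ((((k / l : ℕ) : ℤ) + 2 * (j : ℤ) + 2) * l - ((k % l : ℕ) : ℤ) - 2))

/-- The real character `ch_{T(k)}(x)` of the indecomposable tilting module `T(k)`,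
where `k = k₁ l + k₀` with `0 ≤ k₀ ≤ l−1`. -/
noncomputable def chT (l k : ℕ) (x : ℝ) : ℝ :=
  if k / l = 0 then
    (x ^ (((k % l : ℕ) : ℤ) + 1) - x ^ (-(((k % l : ℕ) : ℤ) + 1))) / (x - x⁻¹)
  else if k % l = l - 1 then
    (x ^ ((((k / l : ℕ) : ℤ) + 1) * l) - x ^ (-((((k / l : ℕ) : ℤ) + 1) * l))) / (x - x⁻¹)
  else
    (x ^ (((k % l : ℕ) : ℤ) + 1) + x ^ (-(((k % l : ℕ) : ℤ) + 1))) *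
      (x ^ (((k / l : ℕ) : ℤ) * l) - x ^ (-(((k / l : ℕ) : ℤ) * l))) / (x - x⁻¹)

open Filter


lemma aux_intBinom (N s : ℕ) (hN : 1 ≤ N) (j : ℤ) (hj : j < s) :
    0 ≤ intBinom N j ∧ (N : ℤ) * intBinom N j ≤ (N : ℤ) ^ s := by
  unfold intBinom
  split_ifs with h
  · refine ⟨by positivity, ?_⟩
    obtain ⟨m, rfl⟩ := Int.eq_ofNat_of_zero_le h.1
    have hm : m + 1 ≤ s := by omega
    have h1 : N.choose m ≤ N ^ m := Nat.choose_le_pow N m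
    have h2 : N * N.choose m ≤ N ^ s :=
      calc N * N.choose m ≤ N * N ^ m := Nat.mul_le_mul_left _ h1
        _ = N ^ (m + 1) := by ring
        _ ≤ N ^ s := Nat.pow_le_pow_right hN hm
    simpa using (by exact_mod_cast h2 : (N : ℤ) * (N.choose m : ℤ) ≤ (N : ℤ) ^ s)
  · simp

lemma aux_F (N : ℕ) (j : ℤ) : Fcoef N ((N : ℤ) - 2 * j) = intBinom N j - intBinom N (j - 1) := by
  unfold Fcoef
  rw [if_pos (by omega)]
  congr 2 <;> omega

lemma aux_Fb (N s : ℕ) (hN : 1 ≤ N) (j : ℤ) (hj : j < s) :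
    |(N : ℤ) * Fcoef N ((N : ℤ) - 2 * j)| ≤ (N : ℤ) ^ s := by
  rw [aux_F, mul_sub, abs_le]
  have h1 := aux_intBinom N s hN j hj
  have h2 := aux_intBinom N s hN (j - 1) (by omega)
  have h3 := mul_nonneg (Int.natCast_nonneg N) h1.1
  have h4 := mul_nonneg (Int.natCast_nonneg N) h2.1
  constructor <;> linarith

lemma aux_F0 (N : ℕ) (j : ℤ) (hj : j < 0) : Fcoef N ((N : ℤ) - 2 * j) = 0 := by
  rw [aux_F]
  unfold intBinom
  rw [if_neg (by omega), if_neg (by omega)]; rfl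

lemma aux_Fs (N s : ℕ) (hN : 1 ≤ N) (hs : s ≤ N) :
    |(N : ℤ) * (Fcoef N ((N : ℤ) - 2 * s) - N.choose s)| ≤ (N : ℤ) ^ s := by
  rw [aux_F]
  have h2 := aux_intBinom N s hN (s - 1) (by omega)
  have h4 := mul_nonneg (Int.natCast_nonneg N) h2.1
  have h5 : intBinom N s = N.choose s := by
    unfold intBinom
    rw [if_pos (by omega)]; simp
  rw [h5, abs_le]
  constructor <;> linarith

lemma aux_M (l s N : ℕ) (hl3 : 3 ≤ l) (hN : 1 ≤ N) (hs : 2 * s ≤ N) :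
    |(N : ℤ) * (Mmult l (N - 2 * s) N - N.choose s)| ≤ (2 * s + 2) * (N : ℤ) ^ s := by
  have hpos : (0 : ℤ) ≤ (N : ℤ) ^ s := by positivity
  have hk : ((N - 2 * s : ℕ) : ℤ) = (N : ℤ) - 2 * s := by omega
  unfold Mmult
  have hs0 := aux_Fs N s hN (by omega)
  split_ifs with h
  · rw [hk]
    refine hs0.trans ?_
    nlinarith
  · have hlt : (N - 2 * s) % l < l := Nat.mod_lt _ (by omega)
    have hdm := Nat.div_add_mod (N - 2 * s) l
    set k := N - 2 * s with hkd
    generalize hq : k / l = q at *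
    generalize hr : k % l = r at *
    have hdm' : (l : ℤ) * q + r = (N : ℤ) - 2 * s := by rw [← hk, ← hdm]; push_cast; ring
    have e1 : ∀ j : ℕ, (k : ℤ) + 2 * j * l = (N : ℤ) - 2 * ((s : ℤ) - j * l) := by
      intro j; rw [hk]; ring
    have e2 : ∀ j : ℕ, ((q : ℤ) + 2 * (j : ℤ) + 2) * l - (r : ℤ) - 2
        = (N : ℤ) - 2 * ((s : ℤ) - j * l - (l - 1 - r)) := by
      intro j; linear_combination hdm'
    simp only [e1, e2]
    have hsub : ∑ j ∈ Finset.range (N + 1),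
        (Fcoef N ((N : ℤ) - 2 * ((s : ℤ) - j * l)) -
          Fcoef N ((N : ℤ) - 2 * ((s : ℤ) - j * l - (l - 1 - r)))) =
        ∑ j ∈ Finset.range (s + 1),
        (Fcoef N ((N : ℤ) - 2 * ((s : ℤ) - j * l)) -
          Fcoef N ((N : ℤ) - 2 * ((s : ℤ) - j * l - (l - 1 - r)))) := by
      symm
      apply Finset.sum_subset
      · intro a ha; simp at *; omega
      · intro j _ hj
        have hj' : s < j := by simpa using hj
        have : (j : ℤ) ≤ j * l := by nlinarith [Int.natCast_nonneg j]
        rw [aux_F0 _ _ (by omega), aux_F0 _ _ (by omega)]; rfl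
    rw [hsub]
    have hc : (N.choose s : ℤ) = ∑ j ∈ Finset.range (s + 1), if j = 0 then (N.choose s : ℤ) else 0 := by
      simp
    rw [hc, ← Finset.sum_sub_distrib, Finset.mul_sum]
    refine (Finset.abs_sum_le_sum_abs _ _).trans ?_
    have : ∀ j ∈ Finset.range (s + 1), |(N : ℤ) * (Fcoef N ((N : ℤ) - 2 * ((s : ℤ) - j * l)) -
          Fcoef N ((N : ℤ) - 2 * ((s : ℤ) - j * l - (l - 1 - r)))
          - if j = 0 then (N.choose s : ℤ) else 0)| ≤ 2 * (N : ℤ) ^ s := by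
      intro j _
      have hjl : (0 : ℤ) ≤ j * l := by positivity
      have hb := aux_Fb N s hN ((s : ℤ) - j * l - (l - 1 - r)) (by omega)
      rw [abs_le] at hb ⊢
      by_cases hj0 : j = 0
      · subst hj0
        rw [abs_le] at hs0
        simp only [Nat.cast_zero, zero_mul, sub_zero, if_true] at hb ⊢
        constructor <;> linarith
      · have h1 : (1 : ℤ) ≤ j := by omega
        have hj2 : (0 : ℤ) < j * l := by positivity
        have ha := aux_Fb N s hN ((s : ℤ) - j * l) (by omega)
        rw [abs_le] at ha
        rw [if_neg hj0]
        constructor <;> linarith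
    refine (Finset.sum_le_sum this).trans ?_
    simp
    apply le_of_eq; ring

lemma aux_ch (l k : ℕ) (hl3 : 3 ≤ l) (hk : l ≤ k) (x : ℝ) (hx : 1 < x) :
    1 ≤ chT l k x / x ^ k ∧ chT l k x / x ^ k ≤ (1 + (x ^ 2)⁻¹) / (1 - (x ^ 2)⁻¹) := by
  have hx0 : 0 < x := by linarith
  have hxn : x ≠ 0 := hx0.ne'
  have hy1 : (x ^ 2)⁻¹ < 1 := inv_lt_one_of_one_lt₀ (by nlinarith)
  have hy0 : 0 < (x ^ 2)⁻¹ := by positivity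
  have hsm : ∀ n : ℕ, 1 ≤ n → 0 < (x ^ (2 * n))⁻¹ ∧ (x ^ (2 * n))⁻¹ ≤ (x ^ 2)⁻¹ := by
    intro n hn
    refine ⟨by positivity, ?_⟩
    exact inv_anti₀ (by positivity) (pow_le_pow_right₀ hx.le (by omega))
  suffices H : ∃ e f : ℝ, 0 ≤ e ∧ e ≤ (x ^ 2)⁻¹ ∧ 0 ≤ f ∧ f ≤ (x ^ 2)⁻¹ ∧
      chT l k x / x ^ k = (1 + e) * (1 - f) / (1 - (x ^ 2)⁻¹) by
    obtain ⟨e, f, he0, he, hf0, hf, h⟩ := H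
    have hd : 0 < 1 - (x ^ 2)⁻¹ := by linarith
    rw [h, le_div_iff₀ hd]
    constructor
    · nlinarith
    · apply div_le_div_of_nonneg_right _ hd.le
      nlinarith
  have hq1 : 1 ≤ k / l := (Nat.one_le_div_iff (by omega)).2 hk
  have hdm := Nat.div_add_mod k l
  have hx2 : x ^ 2 - 1 ≠ 0 := by nlinarith
  have hxx : x - x⁻¹ ≠ 0 := by
    have : x⁻¹ < 1 := inv_lt_one_of_one_lt₀ hx
    linarith
  have hd : 1 - (x ^ 2)⁻¹ ≠ 0 := by linarith
  have hxe : x - x⁻¹ = x * (1 - (x ^ 2)⁻¹) := by field_simp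
  unfold chT
  rw [if_neg (by omega)]
  generalize k / l = q at *
  generalize k % l = r at *
  have hql : 1 ≤ q * l := Nat.mul_pos (by omega) (by omega)
  split_ifs with h
  · refine ⟨0, (x ^ (2 * (k + 1)))⁻¹, le_rfl, hy0.le, (hsm (k+1) (by omega)).1.le,
      (hsm (k+1) (by omega)).2, ?_⟩
    have e : ((q : ℤ) + 1) * l = ((k + 1 : ℕ) : ℤ) := by
      have : (q + 1) * l = k + 1 := by
        have : (q + 1) * l = l * q + l := by ring
        omega
      exact_mod_cast this
    rw [e, zpow_neg, zpow_natCast, hxe]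
    have : x ^ (k + 1) - (x ^ (k + 1))⁻¹ = x * x ^ k * (1 - (x ^ (2 * (k + 1)))⁻¹) := by
      rw [pow_mul', pow_succ]; field_simp
    rw [this]
    field_simp
    ring
  · refine ⟨(x ^ (2 * (r + 1)))⁻¹, (x ^ (2 * (q * l)))⁻¹, (hsm _ (by omega)).1.le,
      (hsm _ (by omega)).2, (hsm _ hql).1.le, (hsm _ hql).2, ?_⟩
    have e : (q : ℤ) * l = ((q * l : ℕ) : ℤ) := by push_cast; ring
    have e' : (r : ℤ) + 1 = ((r + 1 : ℕ) : ℤ) := by push_cast; ring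
    rw [e, e', zpow_neg, zpow_natCast, zpow_neg, zpow_natCast, hxe]
    have h1 : x ^ (r + 1) + (x ^ (r + 1))⁻¹ = x * x ^ r * (1 + (x ^ (2 * (r + 1)))⁻¹) := by
      rw [pow_mul', pow_succ]; field_simp
    have h2 : x ^ (q * l) - (x ^ (q * l))⁻¹ = x ^ (q * l) * (1 - (x ^ (2 * (q * l)))⁻¹) := by
      rw [pow_mul' x 2 (q * l)]; field_simp
    have h3 : x ^ k = x ^ r * x ^ (q * l) := by rw [← pow_add, ← hdm]; congr 1; ring
    rw [h1, h2, h3]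
    generalize (x ^ (2 * (r + 1)))⁻¹ = A
    generalize (x ^ (2 * (q * l)))⁻¹ = B
    have : x ^ (q * l) ≠ 0 := by positivity
    generalize x ^ (q * l) = C at *
    field_simp

lemma aux_choose (s : ℕ) :
    Tendsto (fun N : ℕ => (N.choose s : ℝ) / (N : ℝ) ^ s) atTop (nhds (1 / (s.factorial : ℝ))) := by
  have h1 : Tendsto (fun n : ℕ => (n : ℝ) * (1 / (n : ℝ))) atTop (nhds 1) := by
    refine tendsto_const_nhds.congr' ?_
    filter_upwards [eventually_gt_atTop 0] with n hn
    have : (n : ℝ) ≠ 0 := by positivity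
    field_simp
  have h := ProbabilityTheory.tendsto_choose_mul_pow_atTop s h1
  simpa [div_eq_mul_inv] using h

theorem stmt14 (l s : ℕ) (hl : Odd l) (hl3 : 3 ≤ l) (θ : ℝ) (hθ : 0 < θ) :
    Tendsto (fun N : ℕ =>
        (Mmult l (N - 2 * s) N : ℝ) * chT l (N - 2 * s) (Real.sqrt (N / θ)) /
          (Real.sqrt (N / θ) + (Real.sqrt (N / θ))⁻¹) ^ N)
      atTop (nhds (θ ^ s * Real.exp (-θ) / (s.factorial : ℝ))) := by
  have hinv : Tendsto (fun N : ℕ => θ / (N : ℝ)) atTop (nhds 0) :=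
    tendsto_const_div_atTop_nhds_zero_nat θ
  have T1 : Tendsto (fun N : ℕ => (Mmult l (N - 2 * s) N : ℝ) / (N : ℝ) ^ s) atTop
      (nhds (1 / (s.factorial : ℝ))) := by
    have hz : Tendsto (fun N : ℕ => (Mmult l (N - 2 * s) N : ℝ) / (N : ℝ) ^ s -
        (N.choose s : ℝ) / (N : ℝ) ^ s) atTop (nhds 0) := by
      apply squeeze_zero_norm' _ (tendsto_const_div_atTop_nhds_zero_nat (2 * (s : ℝ) + 2))
      filter_upwards [eventually_ge_atTop (2 * s + 1)] with N hN
      have hN0 : (0 : ℝ) < N := by exact_mod_cast (by omega : 0 < N)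
      have h := aux_M l s N hl3 (by omega) (by omega)
      have h' : |(N : ℝ) * ((Mmult l (N - 2 * s) N : ℝ) - N.choose s)| ≤
          (2 * s + 2) * (N : ℝ) ^ s := by exact_mod_cast h
      rw [abs_mul, abs_of_pos hN0] at h'
      rw [← sub_div, Real.norm_eq_abs, abs_div, abs_of_pos (pow_pos hN0 s),
        div_le_div_iff₀ (by positivity) hN0]
      linarith
    have := hz.add (aux_choose s)
    simpa using this
  have T2 : Tendsto (fun N : ℕ => chT l (N - 2 * s) (Real.sqrt (N / θ)) /
      (Real.sqrt (N / θ)) ^ (N - 2 * s)) atTop (nhds 1) := by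
    have hu : Tendsto (fun N : ℕ => (1 + θ / (N : ℝ)) / (1 - θ / (N : ℝ))) atTop (nhds 1) := by
      have := (hinv.const_add 1).div (hinv.const_sub 1) (by norm_num)
      simp only [add_zero, sub_zero, div_one] at this
      exact this
    have hev : ∀ᶠ N : ℕ in atTop, 1 ≤ chT l (N - 2 * s) (Real.sqrt (N / θ)) /
      (Real.sqrt (N / θ)) ^ (N - 2 * s) ∧ chT l (N - 2 * s) (Real.sqrt (N / θ)) /
      (Real.sqrt (N / θ)) ^ (N - 2 * s) ≤ (1 + θ / (N : ℝ)) / (1 - θ / (N : ℝ)) := by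
      filter_upwards [eventually_ge_atTop (2 * s + l), eventually_gt_atTop ⌈θ⌉₊] with N h1 h2
      have h3 : θ < N := Nat.lt_of_ceil_lt h2
      have hx : 1 < Real.sqrt (N / θ) := by
        rw [Real.lt_sqrt (by norm_num), one_pow, lt_div_iff₀ hθ]; linarith
      have := aux_ch l (N - 2 * s) hl3 (by omega) _ hx
      rwa [Real.sq_sqrt (by positivity), inv_div] at this
    exact tendsto_of_tendsto_of_tendsto_of_le_of_le' tendsto_const_nhds hu
      (hev.mono fun _ h => h.1) (hev.mono fun _ h => h.2)
  have T3 : Tendsto (fun N : ℕ => θ ^ s / (1 + θ / (N : ℝ)) ^ N) atTop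
      (nhds (θ ^ s / Real.exp θ)) :=
    (tendsto_const_nhds).div (Real.tendsto_one_add_div_pow_exp θ) (Real.exp_pos θ).ne'
  have T := (T1.mul T2).mul T3
  have hlim : 1 / (s.factorial : ℝ) * 1 * (θ ^ s / Real.exp θ) =
      θ ^ s * Real.exp (-θ) / (s.factorial : ℝ) := by
    rw [Real.exp_neg]; field_simp
  rw [hlim] at T
  refine T.congr' ?_
  filter_upwards [eventually_ge_atTop (2 * s + 1)] with N hN
  have hN0 : (0 : ℝ) < N := by exact_mod_cast (by omega : 0 < N)
  have hx : 0 < Real.sqrt (N / θ) := Real.sqrt_pos.2 (by positivity)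
  have hx2 : Real.sqrt (N / θ) ^ 2 = N / θ := Real.sq_sqrt (by positivity)
  have hθx : θ / (N : ℝ) = (Real.sqrt (N / θ) ^ 2)⁻¹ := by rw [hx2, inv_div]
  generalize Real.sqrt (N / θ) = x at *
  have hxp : x ^ N = x ^ (N - 2 * s) * ((N : ℝ) / θ) ^ s := by
    rw [← hx2, ← pow_mul, ← pow_add]; congr 1; omega
  have hxx : x + x⁻¹ = x * (1 + θ / (N : ℝ)) := by rw [hθx]; field_simp
  rw [hxx, mul_pow, hxp]
  have hp : 0 < 1 + θ / (N : ℝ) := by positivity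
  have hpN : (1 + θ / (N : ℝ)) ^ N ≠ 0 := by positivity
  generalize (1 + θ / (N : ℝ)) ^ N = P at *
  have hk : x ^ (N - 2 * s) ≠ 0 := by positivity
  generalize x ^ (N - 2 * s) = K at *
  rw [div_pow]
  field_simp
end

section
/- Fix an odd integer l ≥ 3, N₀ ∈ {0, …, 2l−1}, k₀ ∈ {0, …, l−1}, a real t > 0, and α ∈ ℝ. Set ξ₀ := (e^{t} − e^{−t})/(e^{t} + e^{−t}). Let (k₁(n))_{n≥1} be nonnegative integers with k₁(n) ≡ N₀ + k₀ (mod 2) for all n and (k₁(n) − 2nξ₀)/√(2n) → α as n → ∞. For each n set N(n) := 2ln + N₀, k(n) := k₁(n)l + k₀, and p_n := M^{(l)}_{k(n)}(N(n)) · ch_{T(k(n))}(e^{t}) / (e^{t} + e^{−t})^{N(n)}. Then lim_{n→∞} √(n/2) · p_n = p₁(k₀; t) · p₂(α; t), where p₁(k₀; t) := (e^{t(k₀+1)} + e^{−t(k₀+1)})(e^{t(l−1−k₀)} − e^{−t(l−1−k₀)}) / ( l (e^{tl} − e^{−tl}) ) for 0 ≤ k₀ ≤ l−2, p₁(l−1;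 t) := 1/l, and p₂(α; t) := √(l/(2π)) · cosh(t) · exp(−α² l cosh²(t)/2). -/
open Filter Real

lemma g_lim : Tendsto (fun u : ℝ => if u = 0 then (1/2:ℝ) else ((1+u) * log (1+u) - u) / u^2) (nhds 0) (nhds (1/2)) := by
  have key : ∀ᶠ u : ℝ in nhds 0, |(if u = 0 then (1/2:ℝ) else ((1+u) * log (1+u) - u) / u^2) - 1/2| ≤ 4 * |u| := by
    have h1 : ∀ᶠ u : ℝ in nhds 0, |u| < 1/2 := by
      have := Metric.ball_mem_nhds (0:ℝ) (show (0:ℝ) < 1/2 by norm_num)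
      filter_upwards [this] with u hu
      simpa [Real.dist_eq] using hu
    filter_upwards [h1] with u hu
    split_ifs with h0
    · simp [h0]
    · have h2 := Real.abs_log_sub_add_sum_range_le (x := -u) (by rw [abs_neg]; linarith) 2
      simp only [Finset.sum_range_succ, Finset.sum_range_zero, abs_neg] at h2
      norm_num at h2
      have hu0 : 0 < |u| := abs_pos.mpr h0
      have h3 : |u| ^ 3 / (1 - |u|) ≤ 2 * |u|^3 := by
        rw [div_le_iff₀ (by linarith)]
        nlinarith [pow_pos hu0 3]
      set e := -u + u^2/2 + log (1+u) with he
      have h4 : |e| ≤ 2 * |u|^3 := h2.trans h3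
      have h5 : ((1+u) * log (1+u) - u) / u^2 - 1/2 = ((1+u) * e - u^3/2)/u^2 := by
        rw [he]; field_simp; ring
      rw [h5, abs_div, abs_of_nonneg (sq_nonneg u), ← sq_abs u, div_le_iff₀ (by positivity)]
      calc |(1+u) * e - u^3/2| ≤ |(1+u) * e| + |u^3/2| := abs_sub _ _
        _ = |1+u| * |e| + |u|^3/2 := by rw [abs_mul, abs_div, abs_pow]; norm_num
        _ ≤ (3/2) * (2 * |u|^3) + |u|^3/2 := by
          have : |1+u| ≤ 3/2 := (abs_add_le _ _).trans (by norm_num; linarith)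
          gcongr
        _ ≤ 4 * |u| * |u|^2 := by nlinarith [pow_pos hu0 3]
  rw [tendsto_iff_norm_sub_tendsto_zero]
  refine squeeze_zero' (Eventually.of_forall fun _ => norm_nonneg _) key ?_
  have : Tendsto (fun u : ℝ => 4 * |u|) (nhds 0) (nhds (4 * |(0:ℝ)|)) := by
    apply Continuous.tendsto; fun_prop
  simpa using this

lemma ent_lim (A m : ℕ → ℝ) (a y : ℝ) (ha : 0 < a)
    (hA : Tendsto (fun n : ℕ => A n / n) atTop (nhds a))
    (hx : Tendsto (fun n : ℕ => (m n - A n) / sqrt n) atTop (nhds y)) :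
    Tendsto (fun n : ℕ => m n * log (m n / A n) - (m n - A n)) atTop (nhds (y^2/(2*a))) := by
  have hApos : ∀ᶠ n in atTop, 0 < A n := by
    filter_upwards [hA.eventually (lt_mem_nhds ha), eventually_gt_atTop 0] with n h1 h2
    have : (0:ℝ) < n := by exact_mod_cast h2
    by_contra h
    exact absurd h1 (not_lt.mpr (div_nonpos_of_nonpos_of_nonneg (not_lt.mp h) this.le))
  have hs : Tendsto (fun n : ℕ => (sqrt n)⁻¹) atTop (nhds 0) :=
    tendsto_inv_atTop_zero.comp (tendsto_sqrt_atTop.comp tendsto_natCast_atTop_atTop)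
  have hu : Tendsto (fun n : ℕ => (m n - A n) / A n) atTop (nhds 0) := by
    have := (hx.mul hs).div hA ha.ne'
    simp only [mul_zero, zero_div] at this
    refine this.congr' ?_
    filter_upwards [hApos, eventually_gt_atTop 0] with n h1 h2
    have h3 : (0:ℝ) < n := by exact_mod_cast h2
    have h4 := sqrt_pos.mpr h3
    have h5 := Real.sq_sqrt h3.le
    simp only [Pi.div_apply]
    field_simp
    rw [h5]
  have hq : Tendsto (fun n : ℕ => (m n - A n)^2 / A n) atTop (nhds (y^2/a)) := by
    refine ((hx.pow 2).div hA ha.ne').congr' ?_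
    filter_upwards [hApos, eventually_gt_atTop 0] with n h1 h2
    have h3 : (0:ℝ) < n := by exact_mod_cast h2
    have h4 := sqrt_pos.mpr h3
    have h5 := Real.sq_sqrt h3.le
    simp only [Pi.div_apply, div_pow, h5]
    field_simp
  have := hq.mul (g_lim.comp hu)
  rw [show y^2/(2*a) = y^2/a*(1/2) by field_simp]
  refine this.congr' ?_
  filter_upwards [hApos] with n h1
  simp only [Function.comp]
  have h2 : 1 + (m n - A n) / A n = m n / A n := by field_simp; ring
  split_ifs with h0
  · have : m n - A n = 0 := by
      rcases div_eq_zero_iff.mp h0 with h | h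
      · exact h
      · exact absurd h h1.ne'
    have h3 : m n = A n := by linarith
    simp [h3, h1.ne']
  · rw [h2]
    have h3 : m n - A n ≠ 0 := fun h => h0 (by rw [h, zero_div])
    field_simp

lemma stir (m : ℕ → ℕ) (hm : Tendsto m atTop atTop) :
    Tendsto (fun n => ((m n).factorial : ℝ) / (sqrt (2 * π * m n) * (m n / exp 1)^(m n))) atTop (nhds 1) := by
  have h := Stirling.factorial_isEquivalent_stirling
  rw [Asymptotics.isEquivalent_iff_tendsto_one] at h
  · refine (h.comp hm).congr fun n => ?_
    simp only [Function.comp, Pi.div_apply]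
    congr 3
    ring
  · filter_upwards [eventually_gt_atTop 0] with n hn
    have : (0:ℝ) < n := by exact_mod_cast hn
    positivity

lemma lclt (N m : ℕ → ℕ) (p c y : ℝ) (hp : 0 < p) (hp1 : p < 1) (hc : 0 < c)
    (hmN : ∀ᶠ n in atTop, m n ≤ N n)
    (hN : Tendsto (fun n : ℕ => (N n : ℝ) / n) atTop (nhds c))
    (hx : Tendsto (fun n : ℕ => ((m n : ℝ) - N n * p) / sqrt n) atTop (nhds y)) :
    Tendsto (fun n : ℕ => (m n : ℝ) / n) atTop (nhds (c * p)) ∧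
    Tendsto (fun n : ℕ => sqrt n * ((N n).choose (m n) * p ^ (m n) * (1-p)^(N n - m n))) atTop
      (nhds (sqrt (1 / (2 * π * (c * p * (1-p)))) * exp (-(y^2/(2*(c*p*(1-p))))))) := by
  have hp' : 0 < 1 - p := by linarith
  have hs : Tendsto (fun n : ℕ => (sqrt n)⁻¹) atTop (nhds 0) :=
    tendsto_inv_atTop_zero.comp (tendsto_sqrt_atTop.comp tendsto_natCast_atTop_atTop)
  have hm : Tendsto (fun n : ℕ => (m n : ℝ) / n) atTop (nhds (c * p)) := by
    have := (hx.mul hs).add (hN.mul_const p)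
    simp only [mul_zero, zero_add] at this
    refine this.congr' ?_
    filter_upwards [eventually_gt_atTop 0] with n h2
    have h3 : (0:ℝ) < n := by exact_mod_cast h2
    have h4 := sqrt_pos.mpr h3
    have h5 := Real.sq_sqrt h3.le
    field_simp
    rw [h5]; field_simp; ring
  refine ⟨hm, ?_⟩
  have hq : Tendsto (fun n : ℕ => ((N n - m n : ℕ) : ℝ) / n) atTop (nhds (c * (1-p))) := by
    have := hN.sub hm
    rw [show c * (1-p) = c - c * p by ring]
    refine this.congr' ?_
    filter_upwards [hmN] with n h
    rw [Nat.cast_sub h, sub_div]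
  have inf : ∀ (f : ℕ → ℕ) (b : ℝ), 0 < b → Tendsto (fun n : ℕ => (f n : ℝ) / n) atTop (nhds b) →
      Tendsto f atTop atTop := by
    intro f b hb hf
    rw [← tendsto_natCast_atTop_iff (R := ℝ)]
    have := hf.pos_mul_atTop hb (tendsto_natCast_atTop_atTop (R := ℝ))
    refine this.congr' ?_
    filter_upwards [eventually_gt_atTop 0] with n h2
    have h3 : (0:ℝ) < n := by exact_mod_cast h2
    field_simp
  have iN := inf N c hc hN
  have im := inf m _ (by positivity) hm
  have iq := inf (fun n => N n - m n) _ (by positivity) hq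
  have sN := stir N iN
  have sm := stir m im
  have sq := stir (fun n => N n - m n) iq
  have e1 := ent_lim (fun n => N n * p) (fun n => m n) (c * p) y (by positivity)
    (by refine (hN.mul_const p).congr fun n => ?_; ring) hx
  have e2 := ent_lim (fun n => N n * (1-p)) (fun n => ((N n - m n : ℕ) : ℝ)) (c * (1-p)) (-y) (by positivity)
    (by refine (hN.mul_const (1-p)).congr fun n => ?_; ring) (by
      refine hx.neg.congr' ?_
      filter_upwards [hmN] with n h
      rw [Nat.cast_sub h]; ring)
  have hE := ((e1.add e2).neg).rexp
  have hS : Tendsto (fun n : ℕ => sqrt (((N n : ℝ) / n) / (2 * π * ((m n : ℝ) / n * (((N n - m n : ℕ) : ℝ) / n))))) atTop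
      (nhds (sqrt (c / (2 * π * (c * p * (c * (1-p))))))) := by
    refine Tendsto.sqrt (hN.div ((hm.mul hq).const_mul _) (by positivity))
  have hT := ((sN.div (sm.mul sq) (by norm_num)).mul hS).mul hE
  have hlim : (1:ℝ) / (1 * 1) * sqrt (c / (2 * π * (c * p * (c * (1-p))))) * exp (-(y ^ 2 / (2 * (c * p)) + (-y) ^ 2 / (2 * (c * (1 - p)))))
      = sqrt (1 / (2 * π * (c * p * (1-p)))) * exp (-(y^2/(2*(c*p*(1-p))))) := by
    congr 1
    · rw [mul_one, div_one, one_mul]; congr 1; field_simp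
    · congr 2; field_simp; ring
  rw [hlim] at hT
  refine hT.congr' ?_
  filter_upwards [hmN, eventually_gt_atTop 0, im.eventually_gt_atTop 0, iq.eventually_gt_atTop 0] with n h1 h2 h3 h4
  obtain ⟨q, hq⟩ : ∃ q, q = N n - m n := ⟨_, rfl⟩
  have hNn : N n = m n + q := by omega
  simp only [Pi.div_apply, ← hq] at h4 ⊢
  have hch : ((N n).choose (m n) : ℝ) = (N n).factorial / ((m n).factorial * q.factorial) := by
    rw [Nat.cast_choose ℝ h1, hq]
  rw [hch]
  generalize hM : m n = M at *
  generalize hNN : N n = K at *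
  have h2' : (0:ℝ) < n := by exact_mod_cast h2
  have h3' : (0:ℝ) < M := by exact_mod_cast h3
  have h4' : (0:ℝ) < q := by exact_mod_cast h4
  have hK : (K:ℝ) = M + q := by rw [hNn]; push_cast; ring
  have hK' : (0:ℝ) < K := by rw [hK]; positivity
  have hexp : exp (-(M * log (M / (K * p)) - (M - K * p) + (q * log (q / (K * (1 - p))) - (q - K * (1 - p)))))
      = (K * p / M)^M * (K * (1-p) / q)^q := by
    have x1 : (K * p / M : ℝ)^M = exp (M * -log (M / (K * p))) := by
      rw [← Real.log_inv, inv_div, Real.exp_nat_mul, Real.exp_log (by positivity)]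
    have x2 : (K * (1-p) / q : ℝ)^q = exp (q * -log (q / (K * (1-p)))) := by
      rw [← Real.log_inv, inv_div, Real.exp_nat_mul, Real.exp_log (by positivity)]
    rw [x1, x2, ← Real.exp_add]
    congr 1
    rw [hK]; ring
  rw [hexp]
  have hsq : sqrt ((K:ℝ) / n / (2 * π * (M / n * (q / n)))) = sqrt n * sqrt (2 * π * K) / (sqrt (2 * π * M) * sqrt (2 * π * q)) := by
    rw [← Real.sqrt_mul (by positivity), ← Real.sqrt_mul (by positivity), ← Real.sqrt_div (by positivity)]
    congr 1
    field_simp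
  rw [hsq]
  have y1 : sqrt (2 * π * K) ≠ 0 := by positivity
  have y2 : sqrt (2 * π * M) ≠ 0 := by positivity
  have y3 : sqrt (2 * π * q) ≠ 0 := by positivity
  have y4 : (K / exp 1 : ℝ)^K = (K:ℝ)^M * (K:ℝ)^q / (exp 1 ^ M * exp 1 ^ q) := by
    rw [div_pow]; conv_lhs => rw [hNn]
    rw [pow_add, pow_add, ← hNn]
  rw [y4]
  simp only [div_pow, mul_pow]
  field_simp

noncomputable def cc (N m s : ℕ) : ℝ := if s ≤ m then (N.choose (m - s) : ℝ) else 0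

lemma cc_nonneg (N m s : ℕ) : 0 ≤ cc N m s := by unfold cc; split_ifs <;> positivity

lemma cc_succ (N m s : ℕ) (h : m ≤ N) :
    cc N m (s+1) = cc N m s * (((m - s : ℕ) : ℝ) / ((N - m : ℕ) + s + 1)) := by
  unfold cc
  by_cases h1 : s + 1 ≤ m
  · rw [if_pos h1, if_pos (by omega)]
    have h2 := Nat.choose_succ_right_eq N (m - (s+1))
    rw [show m - (s+1) + 1 = m - s by omega, show N - (m - (s+1)) = (N - m) + s + 1 by omega] at h2
    have h3 : (N.choose (m-s) : ℝ) * (m - s : ℕ) = N.choose (m - (s+1)) * ((N - m : ℕ) + s + 1) := by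
      exact_mod_cast h2
    rw [mul_div_assoc', h3, mul_div_assoc, div_self (by positivity), mul_one]
  · rw [if_neg h1, show m - s = 0 by omega]; simp

lemma intBinom_cc (N m s : ℕ) (h : m ≤ N) : (intBinom N ((m:ℤ) - s) : ℝ) = cc N m s := by
  unfold intBinom cc
  by_cases h1 : s ≤ m
  · rw [if_pos h1, if_pos (by omega), show ((m:ℤ) - s).toNat = m - s by omega]; simp
  · rw [if_neg h1, if_neg (by omega)]; simp

lemma Fcoef_cc (N k m s : ℕ) (h : N = k + 2 * m) (z : ℤ) (hz : z = k + 2 * s) :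
    (Fcoef N z : ℝ) = cc N m s - cc N m (s+1) := by
  unfold Fcoef
  rw [if_pos (by omega), show ((N:ℤ) - z)/2 = (m:ℤ) - s by omega,
    show ((N:ℤ) - z - 2)/2 = (m:ℤ) - (s+1 : ℕ) by omega]
  push_cast [← intBinom_cc N m _ (show m ≤ N by omega)]
  rfl

lemma ratio_lim (N m : ℕ → ℕ) (a b : ℝ) (ha : 0 < a) (hb : 0 < b)
    (hmN : ∀ᶠ n in atTop, m n ≤ N n)
    (hm : Tendsto (fun n : ℕ => (m n : ℝ) / n) atTop (nhds a))
    (hq : Tendsto (fun n : ℕ => ((N n - m n : ℕ) : ℝ) / n) atTop (nhds b)) (s : ℕ) :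
    Tendsto (fun n => cc (N n) (m n) s / (N n).choose (m n)) atTop (nhds ((a/b)^s)) := by
  induction s with
  | zero =>
    simp only [pow_zero]
    refine tendsto_const_nhds.congr' ?_
    filter_upwards [hmN] with n h
    have : (0:ℝ) < (N n).choose (m n) := by exact_mod_cast Nat.choose_pos h
    simp [cc, this.ne']
  | succ s ih =>
    have hi : Tendsto (fun n : ℕ => (n:ℝ)⁻¹) atTop (nhds 0) := tendsto_inv_atTop_nhds_zero_nat
    have h1 := (hm.sub (hi.const_mul (s:ℝ))).div (hq.add (hi.const_mul ((s:ℝ)+1))) (by simpa using hb.ne')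
    simp only [mul_zero, sub_zero, add_zero] at h1
    have h2 := ih.mul h1
    rw [pow_succ]
    refine h2.congr' ?_
    have him : ∀ᶠ n in atTop, s ≤ m n := by
      have := hm.pos_mul_atTop ha (tendsto_natCast_atTop_atTop (R := ℝ))
      filter_upwards [this.eventually_ge_atTop (s:ℝ), eventually_gt_atTop 0] with n h h2
      have h3 : (0:ℝ) < n := by exact_mod_cast h2
      rw [div_mul_cancel₀ _ h3.ne'] at h
      exact_mod_cast h
    filter_upwards [hmN, him, eventually_gt_atTop 0] with n h hs h2
    have h3 : (0:ℝ) < n := by exact_mod_cast h2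
    rw [cc_succ _ _ _ h, Nat.cast_sub hs]
    simp only [Pi.div_apply]
    have : ((m n : ℝ) / n - s * (n:ℝ)⁻¹) / (((N n - m n : ℕ):ℝ)/n + (s+1) * (n:ℝ)⁻¹) = (m n - s) / ((N n - m n : ℕ) + s + 1) := by
      field_simp
      ring
    rw [this]; ring

lemma ratio_bound (N m : ℕ) (ρ : ℝ) (h : m ≤ N) (hρ : 0 ≤ ρ) (hm : (m:ℝ) ≤ ρ * (N - m : ℕ)) (s : ℕ) :
    cc N m s / N.choose m ≤ ρ^s := by
  have hC : (0:ℝ) < N.choose m := by exact_mod_cast Nat.choose_pos h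
  induction s with
  | zero => simp [cc, hC.ne']
  | succ s ih =>
    rw [cc_succ _ _ _ h, mul_div_right_comm, pow_succ]
    refine mul_le_mul ih ?_ (by positivity) (by positivity)
    rw [div_le_iff₀ (by positivity)]
    have : ((m - s : ℕ):ℝ) ≤ m := by exact_mod_cast Nat.sub_le _ _
    have h2 : 0 ≤ ρ * (s + 1) := by positivity
    nlinarith

lemma sum_lim (N m : ℕ → ℕ) (a b : ℝ) (ha : 0 < a) (hab : a < b) (l d : ℕ) (hl : 1 ≤ l)
    (hmN : ∀ᶠ n in atTop, m n ≤ N n)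
    (hNn : ∀ n, n ≤ N n)
    (hm : Tendsto (fun n : ℕ => (m n : ℝ) / n) atTop (nhds a))
    (hq : Tendsto (fun n : ℕ => ((N n - m n : ℕ) : ℝ) / n) atTop (nhds b)) :
    Tendsto (fun n => (∑ j ∈ Finset.range (N n + 1),
      ((cc (N n) (m n) (j * l) - cc (N n) (m n) (j*l+1))
        - (cc (N n) (m n) (j * l + d) - cc (N n) (m n) (j*l+d+1)))) / (N n).choose (m n)) atTop
      (nhds ((1 - a/b) * (1 - (a/b)^d) / (1 - (a/b)^l))) := by
  have hb : 0 < b := ha.trans hab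
  have hr0 : 0 < a / b := by positivity
  have hr1 : a / b < 1 := (div_lt_one hb).mpr hab
  obtain ⟨ρ, hρ1, hρ2⟩ := exists_between hr1
  have hρ0 : 0 < ρ := hr0.trans hρ1
  let R : ℕ → ℕ → ℝ := fun n s => cc (N n) (m n) s / (N n).choose (m n)
  have hR := ratio_lim N m a b ha hb hmN hm hq
  let f : ℕ → ℕ → ℝ := fun n j => if j < N n + 1 then
    (R n (j*l) - R n (j*l+1)) - (R n (j*l+d) - R n (j*l+d+1)) else 0
  have hb : ∀ᶠ n in atTop, ∀ s, R n s ≤ ρ ^ s := by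
    have h1 := hm.div hq hb.ne'
    filter_upwards [hmN, h1.eventually (gt_mem_nhds hρ1), hq.eventually (lt_mem_nhds hb), eventually_gt_atTop 0] with n h h2 h4 h5 s
    have h3 : (0:ℝ) < n := by exact_mod_cast h5
    refine ratio_bound _ _ _ h hρ0.le ?_ s
    simp only [Pi.div_apply] at h2
    rw [div_lt_iff₀ h4, mul_div_assoc', div_lt_div_iff_of_pos_right h3] at h2
    exact h2.le
  have key : Tendsto (fun n => ∑' j, f n j) atTop (nhds (∑' j : ℕ, ((a/b)^l)^j * ((1 - a/b) * (1 - (a/b)^d)))) := by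
    refine tendsto_tsum_of_dominated_convergence (bound := fun j => 4 * ρ^j)
      ((summable_geometric_of_lt_one hρ0.le hρ2).mul_left 4) ?_ ?_
    · intro j
      have h1 := ((hR (j*l)).sub (hR (j*l+1))).sub ((hR (j*l+d)).sub (hR (j*l+d+1)))
      have h2 : (a/b)^(j*l) - (a/b)^(j*l+1) - ((a/b)^(j*l+d) - (a/b)^(j*l+d+1)) = ((a/b)^l)^j * ((1 - a/b) * (1 - (a/b)^d)) := by
        rw [← pow_mul, mul_comm l j]; ring
      rw [h2] at h1
      refine h1.congr' ?_
      filter_upwards [eventually_ge_atTop j] with n hn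
      have := hNn n
      simp only [f]
      rw [if_pos (by omega)]
    · filter_upwards [hb] with n hn j
      have hle : ∀ s, j ≤ s → |R n s| ≤ ρ^j := fun s hs => by
        rw [abs_of_nonneg (div_nonneg (cc_nonneg _ _ _) (by positivity))]
        exact (hn s).trans (pow_le_pow_of_le_one hρ0.le hρ2.le hs)
      have hjl : j ≤ j * l := Nat.le_mul_of_pos_right _ hl
      have a1 := abs_le.mp (hle (j*l) hjl)
      have a2 := abs_le.mp (hle (j*l+1) (by omega))
      have a3 := abs_le.mp (hle (j*l+d) (by omega))
      have a4 := abs_le.mp (hle (j*l+d+1) (by omega))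
      have : 0 ≤ ρ^j := by positivity
      simp only [f]
      split_ifs
      · rw [Real.norm_eq_abs, abs_le]; constructor <;> linarith
      · simpa using this
  rw [tsum_mul_right, tsum_geometric_of_lt_one (by positivity) (pow_lt_one₀ hr0.le hr1 (by omega)), inv_mul_eq_div] at key
  refine key.congr fun n => ?_
  rw [tsum_eq_sum (s := Finset.range (N n + 1)), Finset.sum_div]
  · refine Finset.sum_congr rfl fun j hj => ?_
    simp only [f, R]
    rw [if_pos (Finset.mem_range.mp hj)]; ring
  · intro j hj
    simp only [f]
    rw [if_neg (fun h => hj (Finset.mem_range.mpr h))]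

lemma Mmult_last (l k₁ k₀ N m : ℕ) (hl3 : 3 ≤ l) (hk₀ : k₀ = l - 1)
    (h : N = (k₁ * l + k₀) + 2 * m) :
    (Mmult l (k₁ * l + k₀) N : ℝ) = cc N m 0 - cc N m 1 := by
  have h1 : (k₁ * l + k₀) % l = k₀ := by
    rw [Nat.mul_add_mod_self_right, Nat.mod_eq_of_lt (by omega)]
  unfold Mmult
  rw [h1, if_pos hk₀]
  exact Fcoef_cc N _ m 0 h _ (by simp)

lemma Mmult_gen (l k₁ k₀ N m d : ℕ) (hl3 : 3 ≤ l) (hk₀ : k₀ + 1 + d = l) (hd : d ≠ 0)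
    (h : N = (k₁ * l + k₀) + 2 * m) :
    (Mmult l (k₁ * l + k₀) N : ℝ) = ∑ j ∈ Finset.range (N + 1),
      ((cc N m (j * l) - cc N m (j*l+1)) - (cc N m (j * l + d) - cc N m (j*l+d+1))) := by
  have h1 : (k₁ * l + k₀) % l = k₀ := by
    rw [Nat.mul_add_mod_self_right, Nat.mod_eq_of_lt (by omega)]
  have h2 : (k₁ * l + k₀) / l = k₁ := by
    rw [Nat.add_comm, Nat.add_mul_div_right _ _ (by omega), Nat.div_eq_of_lt (by omega), zero_add]
  unfold Mmult
  rw [h1, h2, if_neg (by omega)]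
  push_cast
  refine Finset.sum_congr rfl fun j _ => ?_
  rw [Fcoef_cc N _ m (j*l) h _ (by push_cast; ring), Fcoef_cc N _ m (j*l+d) h]
  have : (l:ℤ) = k₀ + 1 + d := by exact_mod_cast hk₀.symm
  push_cast
  rw [this]; ring

lemma exp_zp (t : ℝ) (z : ℤ) : exp t ^ z = exp (z * t) := by
  rw [← Real.rpow_intCast, ← Real.exp_mul, mul_comm]

lemma ch_last (l k₀ : ℕ) (hl3 : 3 ≤ l) (hk₀ : k₀ = l - 1) (t : ℝ) (ht : 0 < t)
    (k₁ : ℕ → ℕ) (hk : Tendsto k₁ atTop atTop) :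
    Tendsto (fun n => chT l (k₁ n * l + k₀) (exp t) / exp (t * (k₁ n * l + k₀))) atTop
      (nhds (exp t / (exp t - exp (-t)))) := by
  have hk' : Tendsto (fun n => exp (-(2 * t * (k₁ n * l + k₀) + t))) atTop (nhds 0) := by
    refine Real.tendsto_exp_neg_atTop_nhds_zero.comp ?_
    refine tendsto_atTop_add_const_right _ _ (Tendsto.const_mul_atTop (by positivity) ?_)
    refine tendsto_atTop_add_const_right _ _ (Tendsto.atTop_mul_const (by positivity) ?_)
    exact tendsto_natCast_atTop_atTop.comp hk
  have := ((tendsto_const_nhds (x := exp t)).sub hk').div_const (exp t - exp (-t))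
  rw [sub_zero] at this
  refine this.congr' ?_
  filter_upwards [hk.eventually_gt_atTop 0] with n hn
  have h1 : (k₁ n * l + k₀) % l = k₀ := by
    rw [Nat.mul_add_mod_self_right, Nat.mod_eq_of_lt (by omega)]
  have h2 : (k₁ n * l + k₀) / l = k₁ n := by
    rw [Nat.add_comm, Nat.add_mul_div_right _ _ (by omega), Nat.div_eq_of_lt (by omega), zero_add]
  unfold chT
  rw [h1, h2, if_neg (by omega), if_pos hk₀, ← Real.exp_neg, exp_zp, exp_zp, div_right_comm, sub_div _ _ (exp (t * _)), ← Real.exp_sub, ← Real.exp_sub]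
  have hl' : (l:ℝ) = k₀ + 1 := by
    have : l = k₀ + 1 := by omega
    exact_mod_cast this
  congr 3
  · push_cast; rw [hl']; ring
  · push_cast; rw [hl']; ring

lemma ch_gen (l k₀ : ℕ) (hl3 : 3 ≤ l) (hk₀ : k₀ < l - 1) (t : ℝ) (ht : 0 < t)
    (k₁ : ℕ → ℕ) (hk : Tendsto k₁ atTop atTop) :
    Tendsto (fun n => chT l (k₁ n * l + k₀) (exp t) / exp (t * (k₁ n * l + k₀))) atTop
      (nhds ((exp (t * (k₀ + 1)) + exp (-(t * (k₀ + 1)))) * exp (-(t * k₀)) / (exp t - exp (-t)))) := by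
  have hk' : Tendsto (fun n => exp (-(2 * t * (k₁ n * l) + t * k₀))) atTop (nhds 0) := by
    refine Real.tendsto_exp_neg_atTop_nhds_zero.comp ?_
    refine tendsto_atTop_add_const_right _ _ (Tendsto.const_mul_atTop (by positivity) ?_)
    refine (Tendsto.atTop_mul_const (by positivity) ?_)
    exact tendsto_natCast_atTop_atTop.comp hk
  have := (((tendsto_const_nhds (x := exp (-(t*k₀)))).sub hk').const_mul (exp (t * (k₀ + 1)) + exp (-(t * (k₀ + 1))))).div_const (exp t - exp (-t))
  rw [sub_zero] at this
  refine this.congr' ?_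
  filter_upwards [hk.eventually_gt_atTop 0] with n hn
  have h1 : (k₁ n * l + k₀) % l = k₀ := by
    rw [Nat.mul_add_mod_self_right, Nat.mod_eq_of_lt (by omega)]
  have h2 : (k₁ n * l + k₀) / l = k₁ n := by
    rw [Nat.add_comm, Nat.add_mul_div_right _ _ (by omega), Nat.div_eq_of_lt (by omega), zero_add]
  unfold chT
  rw [h1, h2, if_neg (by omega), if_neg (by omega), ← Real.exp_neg, exp_zp, exp_zp, exp_zp, exp_zp, div_right_comm, mul_div_assoc _ _ (exp (t * _)), sub_div, ← Real.exp_sub, ← Real.exp_sub]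
  congr 1
  congr 1
  · congr 2
    · push_cast; ring
    · push_cast; ring
  · congr 2
    · push_cast; ring
    · push_cast; ring

lemma core (l N₀ k₀ : ℕ) (hl : Odd l) (hl3 : 3 ≤ l) (t α : ℝ) (ht : 0 < t)
    (k₁ : ℕ → ℕ) (hpar : ∀ n, k₁ n % 2 = (N₀ + k₀) % 2)
    (hconv : Tendsto (fun n : ℕ =>
        ((k₁ n : ℝ) - 2 * n * ((Real.exp t - Real.exp (-t)) / (Real.exp t + Real.exp (-t)))) /
          Real.sqrt (2 * n)) atTop (nhds α)) :
    ∃ m : ℕ → ℕ, (∀ᶠ n in atTop, 2 * l * n + N₀ = (k₁ n * l + k₀) + 2 * m n) ∧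
      Tendsto k₁ atTop atTop ∧
      Tendsto (fun n : ℕ => (m n : ℝ) / n) atTop (nhds (2 * l * (exp (-t) / (exp t + exp (-t))))) ∧
      Tendsto (fun n : ℕ => ((2 * l * n + N₀ - m n : ℕ) : ℝ) / n) atTop (nhds (2 * l * (exp t / (exp t + exp (-t))))) ∧
      Tendsto (fun n : ℕ => sqrt (n/2) * ((2 * l * n + N₀).choose (m n) * exp (t * (k₁ n * l + k₀)) / (exp t + exp (-t)) ^ (2 * l * n + N₀)))
       atTop (nhds (1 / l * (Real.sqrt ((l : ℝ) / (2 * π)) * Real.cosh t *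
            Real.exp (-(α ^ 2 * l * Real.cosh t ^ 2 / 2))))) := by
  set Z := exp t + exp (-t) with hZ
  have hZ0 : 0 < Z := by positivity
  have hl0 : (0:ℝ) < l := by positivity
  set ξ := (exp t - exp (-t)) / Z with hξ
  have hlt : exp (-t) < exp t := Real.exp_lt_exp.mpr (by linarith)
  have hξ0 : 0 < ξ := div_pos (by linarith) hZ0
  have hξ1 : ξ < 1 := by rw [hξ, div_lt_one hZ0, hZ]; linarith [exp_pos (-t)]
  set p := exp (-t) / Z with hp
  have hp0 : 0 < p := by positivity
  have hpq : 1 - p = exp t / Z := by rw [hp, eq_div_iff hZ0.ne', sub_mul, div_mul_cancel₀ _ hZ0.ne', hZ]; ring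
  have hp1 : p < 1 := by have : 0 < exp t / Z := by positivity
                         linarith
  have hξp : ξ = 1 - 2 * p := by rw [hξ, hp, hZ]; field_simp; ring
  have hs : Tendsto (fun n : ℕ => (sqrt n)⁻¹) atTop (nhds 0) :=
    tendsto_inv_atTop_zero.comp (tendsto_sqrt_atTop.comp tendsto_natCast_atTop_atTop)
  have hi : Tendsto (fun n : ℕ => (n:ℝ)⁻¹) atTop (nhds 0) := tendsto_inv_atTop_nhds_zero_nat
  have hk1 : Tendsto (fun n : ℕ => (k₁ n : ℝ) / n) atTop (nhds (2 * ξ)) := by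
    have := ((hconv.mul hs).mul_const (sqrt 2)).add_const (2 * ξ)
    simp only [mul_zero, zero_mul, zero_add] at this
    refine this.congr' ?_
    filter_upwards [eventually_gt_atTop 0] with n h2
    have h3 : (0:ℝ) < n := by exact_mod_cast h2
    have h4 := sqrt_pos.mpr h3
    have h5 := Real.sq_sqrt h3.le
    rw [Real.sqrt_mul (by norm_num)]
    field_simp
    rw [h5]; field_simp; ring
  have hkinf : Tendsto k₁ atTop atTop := by
    rw [← tendsto_natCast_atTop_iff (R := ℝ)]
    have := hk1.pos_mul_atTop (by positivity) (tendsto_natCast_atTop_atTop (R := ℝ))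
    refine this.congr' ?_
    filter_upwards [eventually_gt_atTop 0] with n h2
    have h3 : (0:ℝ) < n := by exact_mod_cast h2
    field_simp
  let m : ℕ → ℕ := fun n => (2 * l * n + N₀ - (k₁ n * l + k₀)) / 2
  have hm : ∀ᶠ n in atTop, 2 * l * n + N₀ = (k₁ n * l + k₀) + 2 * m n := by
    have h1 : Tendsto (fun n : ℕ => (k₁ n : ℝ) / n * l + k₀ * (n:ℝ)⁻¹) atTop (nhds (2 * ξ * l + k₀ * 0)) :=
      (hk1.mul_const _).add (hi.const_mul _)
    have h2 : 2 * ξ * l + k₀ * 0 < 2 * l := by nlinarith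
    filter_upwards [h1.eventually (gt_mem_nhds h2), eventually_gt_atTop 0] with n h3 h4
    have h5 : (0:ℝ) < n := by exact_mod_cast h4
    have h6 : (k₁ n : ℝ) * l + k₀ < 2 * l * n := by
      have : ((k₁ n : ℝ) / n * l + k₀ * (n:ℝ)⁻¹) * n < 2 * l * n := by gcongr
      field_simp at this
      linarith
    have h7 : k₁ n * l + k₀ < 2 * l * n := by exact_mod_cast h6
    have h8 : (k₁ n * l) % 2 = k₁ n % 2 := by
      rw [Nat.mul_mod, Nat.odd_iff.mp hl]; simp
    have h9 := hpar n
    have h10 : (2 * l * n) % 2 = 0 := by rw [mul_assoc]; simp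
    simp only [m]
    generalize k₁ n * l = A at *
    generalize 2 * l * n = B at *
    omega
  have hmR : ∀ᶠ n in atTop, (m n : ℝ) = (2 * l * n + N₀ - (k₁ n * l + k₀)) / 2 := by
    filter_upwards [hm] with n h
    have : (2 * l * n + N₀ : ℝ) = (k₁ n * l + k₀) + 2 * m n := by exact_mod_cast h
    linarith
  have hmN : ∀ᶠ n in atTop, m n ≤ 2 * l * n + N₀ := by
    filter_upwards [hm] with n h
    omega
  have hN : Tendsto (fun n : ℕ => ((2 * l * n + N₀ : ℕ) : ℝ) / n) atTop (nhds (2 * l)) := by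
    have := (hi.const_mul (N₀:ℝ)).const_add (2 * l : ℝ)
    rw [mul_zero, add_zero] at this
    refine this.congr' ?_
    filter_upwards [eventually_gt_atTop 0] with n h2
    have h3 : (0:ℝ) < n := by exact_mod_cast h2
    push_cast
    field_simp
  have hx : Tendsto (fun n : ℕ => ((m n : ℝ) - (2 * l * n + N₀ : ℕ) * p) / sqrt n) atTop (nhds (-(l * sqrt 2 / 2) * α)) := by
    have := (hconv.const_mul (-(l * sqrt 2 / 2))).add (hs.const_mul ((N₀ * ξ - k₀)/2))
    rw [mul_zero, add_zero] at this
    refine this.congr' ?_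
    filter_upwards [eventually_gt_atTop 0, hmR] with n h2 h3
    have h3 : (0:ℝ) < n := by exact_mod_cast h2
    have h4 := sqrt_pos.mpr h3
    rw [Real.sqrt_mul (by norm_num), ‹(m n : ℝ) = _›, hξp]
    push_cast
    field_simp
    ring
  obtain ⟨L1, L2⟩ := lclt (fun n => 2 * l * n + N₀) m p (2 * l) _ hp0 hp1 (by positivity) hmN hN hx
  refine ⟨m, hm, hkinf, L1, ?_, ?_⟩
  · rw [← hpq]
    have := hN.sub L1
    rw [show 2 * l * (1-p) = 2 * l - 2 * l * p by ring]
    refine this.congr' ?_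
    filter_upwards [hmN] with n h
    rw [Nat.cast_sub h, sub_div]
  · have L3 := L2.const_mul (sqrt (1/2))
    have hc : cosh t = Z / 2 := Real.cosh_eq t
    have hpp : p * (1 - p) = 1 / (4 * cosh t ^ 2) := by
      rw [hpq, hp, hc]
      have : exp (-t) * exp t = 1 := by rw [← Real.exp_add]; simp
      field_simp
      linarith
    have hlim : sqrt (1/2) * (sqrt (1 / (2 * π * (2 * l * p * (1-p)))) * exp (-((-(l * sqrt 2 / 2) * α)^2/(2*(2 * l*p*(1-p)))))) = 1 / l * (Real.sqrt ((l : ℝ) / (2 * π)) * Real.cosh t *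
            Real.exp (-(α ^ 2 * l * Real.cosh t ^ 2 / 2))) := by
      have hcp := Real.cosh_pos t
      rw [mul_assoc (2 * (l:ℝ)), hpp]
      have hA : sqrt (1/2) * sqrt (1 / (2 * π * (2 * l * (1 / (4 * cosh t ^ 2))))) = 1 / l * (sqrt ((l : ℝ) / (2 * π)) * cosh t) := by
        rw [← Real.sqrt_mul (by norm_num)]
        refine (Real.sqrt_eq_iff_mul_self_eq (by positivity) (by positivity)).mpr ?_
        have := Real.mul_self_sqrt (show 0 ≤ (l:ℝ) / (2 * π) by positivity)
        symm
        calc _ = 1 / (l:ℝ)^2 * (sqrt (l / (2 * π)) * sqrt (l / (2 * π))) * cosh t ^ 2 := by ring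
          _ = _ := by rw [this]; field_simp; try norm_num
      have hB : -((-(l * sqrt 2 / 2) * α)^2/(2*(2 * l*(1 / (4 * cosh t ^ 2))))) = -(α ^ 2 * l * Real.cosh t ^ 2 / 2) := by
        have := Real.sq_sqrt (show (0:ℝ) ≤ 2 by norm_num)
        rw [mul_pow, neg_sq, div_pow, mul_pow, this]
        field_simp
        ring
      rw [hB, ← mul_assoc, hA, mul_assoc]
    rw [hlim] at L3
    refine L3.congr' ?_
    filter_upwards [hm] with n h
    have h1 : 2 * l * n + N₀ - m n = (k₁ n * l + k₀) + m n := by omega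
    rw [h1, hpq, hp, div_pow, div_pow, ← mul_assoc, ← Real.sqrt_mul (by norm_num), ← Real.exp_nat_mul, ← Real.exp_nat_mul]
    have h2 : Z ^ (2 * l * n + N₀) = Z ^ (m n) * Z ^ ((k₁ n * l + k₀) + m n) := by
      rw [← pow_add]; congr 1; omega
    have h3 : exp (t * (k₁ n * l + k₀)) = exp (m n * -t) * exp (((k₁ n * l + k₀ + m n : ℕ):ℝ) * t) := by
      rw [← Real.exp_add]; congr 1; push_cast; ring
    rw [h2, h3, show (1/2 * (n:ℝ)) = n / 2 by ring]
    field_simp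

theorem stmt15 (l N₀ k₀ : ℕ) (hl : Odd l) (hl3 : 3 ≤ l)
    (hN₀ : N₀ ≤ 2 * l - 1) (hk₀ : k₀ ≤ l - 1) (t α : ℝ) (ht : 0 < t)
    (k₁ : ℕ → ℕ) (hpar : ∀ n, k₁ n % 2 = (N₀ + k₀) % 2)
    (hconv : Tendsto (fun n : ℕ =>
        ((k₁ n : ℝ) - 2 * n * ((Real.exp t - Real.exp (-t)) / (Real.exp t + Real.exp (-t)))) /
          Real.sqrt (2 * n)) atTop (nhds α)) :
    Tendsto (fun n : ℕ => Real.sqrt (n / 2) *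
        ((Mmult l (k₁ n * l + k₀) (2 * l * n + N₀) : ℝ) *
          chT l (k₁ n * l + k₀) (Real.exp t) /
          (Real.exp t + Real.exp (-t)) ^ (2 * l * n + N₀)))
      atTop (nhds
        ((if k₀ = l - 1 then 1 / (l : ℝ) else
            (Real.exp (t * (k₀ + 1)) + Real.exp (-(t * (k₀ + 1)))) *
              (Real.exp (t * ((l : ℝ) - 1 - k₀)) - Real.exp (-(t * ((l : ℝ) - 1 - k₀)))) /
              ((l : ℝ) * (Real.exp (t * l) - Real.exp (-(t * l))))) *
          (Real.sqrt ((l : ℝ) / (2 * π)) * Real.cosh t *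
            Real.exp (-(α ^ 2 * l * Real.cosh t ^ 2 / 2))))) := by
  obtain ⟨m, hm, hk, hma, hqb, hD⟩ := core l N₀ k₀ hl hl3 t α ht k₁ hpar hconv
  set Z := exp t + exp (-t) with hZ
  have hZ0 : 0 < Z := by positivity
  have hl0 : (0:ℝ) < l := by positivity
  have hlt : exp (-t) < exp t := Real.exp_lt_exp.mpr (by linarith)
  have hmN : ∀ᶠ n in atTop, m n ≤ 2 * l * n + N₀ := by
    filter_upwards [hm] with n h
    omega
  have hNn : ∀ n, n ≤ 2 * l * n + N₀ := fun n => by nlinarith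
  have hr : (2 * l * (exp (-t) / Z)) / (2 * l * (exp t / Z)) = exp (-(2*t)) := by
    rw [show -(2*t) = -t - t by ring, Real.exp_sub]; field_simp
  -- combine
  have comb : ∀ x y : ℝ, Tendsto (fun n => (Mmult l (k₁ n * l + k₀) (2 * l * n + N₀) : ℝ) / ((2 * l * n + N₀).choose (m n))) atTop (nhds x) →
      Tendsto (fun n => chT l (k₁ n * l + k₀) (exp t) / exp (t * (k₁ n * l + k₀))) atTop (nhds y) →
      Tendsto (fun n : ℕ => Real.sqrt (n / 2) *
        ((Mmult l (k₁ n * l + k₀) (2 * l * n + N₀) : ℝ) *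
          chT l (k₁ n * l + k₀) (Real.exp t) / Z ^ (2 * l * n + N₀)))
      atTop (nhds (1 / l * (Real.sqrt ((l : ℝ) / (2 * π)) * Real.cosh t *
            Real.exp (-(α ^ 2 * l * Real.cosh t ^ 2 / 2))) * (x * y))) := by
    intro x y h1 h2
    refine (hD.mul (h1.mul h2)).congr' ?_
    filter_upwards [hmN] with n h
    have : (0:ℝ) < (2 * l * n + N₀).choose (m n) := by exact_mod_cast Nat.choose_pos h
    field_simp
  have hd0 : exp t - exp (-t) ≠ 0 := by linarith
  split_ifs with hcase
  · have h1 : Tendsto (fun n => (Mmult l (k₁ n * l + k₀) (2 * l * n + N₀) : ℝ) / ((2 * l * n + N₀).choose (m n))) atTop (nhds (1 - exp (-(2*t)))) := by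
      have r0 := ratio_lim _ m _ _ (by positivity) (by positivity) hmN hma hqb 0
      have r1 := ratio_lim _ m _ _ (by positivity) (by positivity) hmN hma hqb 1
      rw [hr] at r0 r1
      have := r0.sub r1
      rw [pow_zero, pow_one] at this
      refine this.congr' ?_
      filter_upwards [hm] with n h
      rw [Mmult_last l _ _ _ (m n) hl3 hcase h, sub_div]
    have h2 := comb _ _ h1 (ch_last l k₀ hl3 hcase t ht k₁ hk)
    have : (1 - exp (-(2*t))) * (exp t / (exp t - exp (-t))) = 1 := by
      rw [mul_div_assoc', sub_mul, ← Real.exp_add, one_mul, show -(2*t) + t = -t by ring, div_self hd0]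
    rw [this, mul_one] at h2
    exact h2
  · obtain ⟨d, hd⟩ : ∃ d, k₀ + 1 + d = l := ⟨l - 1 - k₀, by omega⟩
    have h1 : Tendsto (fun n => (Mmult l (k₁ n * l + k₀) (2 * l * n + N₀) : ℝ) / ((2 * l * n + N₀).choose (m n))) atTop
        (nhds ((1 - exp (-(2*t))) * (1 - exp (-(2*t))^d) / (1 - exp (-(2*t))^l))) := by
      have := sum_lim _ m _ _ (by positivity) (by gcongr) l d (by omega) hmN hNn hma hqb
      rw [hr] at this
      refine this.congr' ?_
      filter_upwards [hm] with n h
      rw [Mmult_gen l _ _ _ (m n) d hl3 hd (by omega) h]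
    have h2 := comb _ _ h1 (ch_gen l k₀ hl3 (by omega) t ht k₁ hk)
    convert h2 using 2
    have hd' : (l:ℝ) - 1 - k₀ = d := by rw [← hd]; push_cast; ring
    have hlt2 : exp (-(t * l)) < exp (t * l) := Real.exp_lt_exp.mpr (by nlinarith)
    have e1 : 1 - exp (-(2*t)) = exp (-t) * (exp t - exp (-t)) := by
      rw [mul_sub, ← Real.exp_add, ← Real.exp_add]; ring_nf; simp; ring
    have e2 : 1 - exp (-(2*t))^d = exp (-(t*d)) * (exp (t*d) - exp (-(t*d))) := by
      rw [mul_sub, ← Real.exp_add, ← Real.exp_add, ← Real.exp_nat_mul]; ring_nf; simp; ring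
    have e3 : 1 - exp (-(2*t))^l = exp (-(t*l)) * (exp (t*l) - exp (-(t*l))) := by
      rw [mul_sub, ← Real.exp_add, ← Real.exp_add, ← Real.exp_nat_mul]; ring_nf; simp; ring
    have e4 : exp (-(t*l)) = exp (-t) * exp (-(t*d)) * exp (-(t*k₀)) := by
      rw [← Real.exp_add, ← Real.exp_add, ← hd]; congr 1; push_cast; ring
    have hd2 : exp (t*l) - exp (-(t*l)) ≠ 0 := by linarith
    rw [hd', e1, e2, e3]
    generalize exp (t*l) - exp (-(t*l)) = W at *
    rw [e4]
    field_simp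
end

section
/- Fix an odd integer l ≥ 3, N₀ ∈ {0, …, 2l−1}, k₀ ∈ {0, …, l−1}, and reals u > 0, b > 0. Let (k₁(n))_{n≥1} be nonnegative integers with k₁(n) ≡ N₀ + k₀ (mod 2) for all n and k₁(n)/√(2n) → b as n → ∞. For each n set t_n := u/√(2n), N(n) := 2ln + N₀, k(n) := k₁(n)l + k₀, and p_n := M^{(l)}_{k(n)}(N(n)) · ch_{T(k(n))}(e^{t_n}) / (e^{t_n} + e^{−t_n})^{N(n)}. Then lim_{n→∞} √(n/2) · p_n = p₁(k₀) · p₂(b; u), where p₁(k₀) := 2(l−1−k₀)/l² for 0 ≤ k₀ ≤ l−2, p₁(l−1) := 1/l, and p₂(b; u) := (b/u) ·√(l/(2π)) · (e^{lbu} − e^{−lbu}) · e^{−u² l/2} · e^{−b² l/2}. -/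
open Filter Real

lemma intBinom_sub (N q : ℕ) : intBinom N ((N : ℤ) - q) = N.choose q := by
  unfold intBinom
  split_ifs with h
  · have hq : q ≤ N := by omega
    have : ((N : ℤ) - q).toNat = N - q := by omega
    rw [this, Nat.choose_symm hq]
  · have hq : N < q := by omega
    simp [Nat.choose_eq_zero_of_lt hq]

lemma Fcoef_eq (N q : ℕ) (k : ℤ) (h : (N : ℤ) + k = 2 * q) :
    Fcoef N k = (N.choose q : ℤ) - N.choose (q + 1) := by
  unfold Fcoef
  have h1 : ((N : ℤ) - k) / 2 = (N : ℤ) - q := by omega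
  have h2 : ((N : ℤ) - k - 2) / 2 = (N : ℤ) - ((q + 1 : ℕ) : ℤ) := by push_cast; omega
  rw [if_pos (by omega), h1, h2, intBinom_sub, intBinom_sub]

lemma sum_blocks (f : ℕ → ℝ) (R l : ℕ) :
    ∑ j ∈ Finset.range R, ∑ r ∈ Finset.range l, f (j * l + r) =
      ∑ i ∈ Finset.range (R * l), f i := by
  induction R with
  | zero => simp
  | succ R ih => rw [Finset.sum_range_succ, ih, Nat.succ_mul, Finset.sum_range_add]

lemma diff_bound (G : ℕ → ℝ) (s l i i' : ℕ) (hi : i < l) (hi' : i' < l) :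
    |G (s + i) - G (s + i')| ≤ ∑ r ∈ Finset.range l, |G (s + r) - G (s + r + 1)| := by
  wlog h : i ≤ i' generalizing i i'
  · rw [abs_sub_comm]; exact this i' i hi' hi (by omega)
  have key : ∀ m, G (s + i) - G (s + (i + m)) =
      ∑ r ∈ Finset.Ico i (i + m), (G (s + r) - G (s + r + 1)) := by
    intro m
    induction m with
    | zero => simp
    | succ m ih =>
      rw [← add_assoc i m 1, Finset.sum_Ico_succ_top (by omega), ← ih, ← add_assoc s (i+m) 1]; ring
  obtain ⟨m, rfl⟩ := Nat.exists_eq_add_of_le h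
  rw [key]
  refine (Finset.abs_sum_le_sum_abs _ _).trans ?_
  apply Finset.sum_le_sum_of_subset_of_nonneg
  · intro x hx; simp at hx ⊢; omega
  · intros; positivity

lemma comb_bound (F : ℕ → ℝ) (R l d : ℕ) (hd : d ≤ l) (hF : F (R * l) = 0) :
    |(l : ℝ) * (∑ j ∈ Finset.range R, (F (j * l) - F (j * l + d))) - d * F 0| ≤
      d * l * ∑ i ∈ Finset.range (R * l), |F i - 2 * F (i + 1) + F (i + 2)| := by
  set G : ℕ → ℝ := fun i => F i - F (i + 1) with hG
  have tel : ∀ s m, F s - F (s + m) = ∑ i ∈ Finset.range m, G (s + i) := by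
    intro s m
    induction m with
    | zero => simp
    | succ m ih => rw [Finset.sum_range_succ, ← ih]; simp only [hG]; rw [← add_assoc]; ring
  have h0 : F 0 = ∑ j ∈ Finset.range R, (F (j * l) - F (j * l + l)) := by
    have : ∀ j, F (j * l) - F (j * l + l) = F (j * l) - F ((j + 1) * l) := by
      intro j; rw [Nat.succ_mul]
    simp_rw [this]
    rw [Finset.sum_range_sub' (fun j => F (j * l))]
    simp [hF]
  have hj : ∀ j, |(l : ℝ) * (F (j * l) - F (j * l + d)) - d * (F (j * l) - F (j * l + l))| ≤
      d * l * ∑ r ∈ Finset.range l, |F (j * l + r) - 2 * F (j * l + r + 1) + F (j * l + r + 2)| := by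
    intro j
    rw [tel, tel]
    have : (l : ℝ) * ∑ i ∈ Finset.range d, G (j * l + i) - d * ∑ i ∈ Finset.range l, G (j * l + i)
        = ∑ i ∈ Finset.range d, ∑ i' ∈ Finset.range l, (G (j * l + i) - G (j * l + i')) := by
      simp [Finset.sum_sub_distrib, Finset.mul_sum]
    rw [this]
    have hb : ∀ i ∈ Finset.range d, ∀ i' ∈ Finset.range l, |G (j * l + i) - G (j * l + i')| ≤
        ∑ r ∈ Finset.range l, |F (j * l + r) - 2 * F (j * l + r + 1) + F (j * l + r + 2)| := by
      intro i hi i' hi'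
      simp only [Finset.mem_range] at hi hi'
      refine (diff_bound G (j * l) l i i' (by omega) hi').trans (le_of_eq ?_)
      refine Finset.sum_congr rfl fun r _ => ?_
      simp only [hG]; congr 1
      ring_nf
    refine (Finset.abs_sum_le_sum_abs _ _).trans ?_
    refine (Finset.sum_le_sum fun i hi => (Finset.abs_sum_le_sum_abs _ _).trans
      (Finset.sum_le_sum (hb i hi))).trans (le_of_eq ?_)
    simp [mul_assoc]
  rw [← sum_blocks, h0, Finset.mul_sum, Finset.mul_sum, Finset.mul_sum, ← Finset.sum_sub_distrib]
  exact (Finset.abs_sum_le_sum_abs _ _).trans (Finset.sum_le_sum fun j _ => hj j)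

open Polynomial in
lemma dom_mul {p q P Q : ℝ[X]} (hp : ∀ i, |p.coeff i| ≤ P.coeff i)
    (hq : ∀ i, |q.coeff i| ≤ Q.coeff i) (i : ℕ) : |(p * q).coeff i| ≤ (P * Q).coeff i := by
  rw [coeff_mul, coeff_mul]
  refine (Finset.abs_sum_le_sum_abs _ _).trans (Finset.sum_le_sum fun x _ => ?_)
  rw [abs_mul]
  exact mul_le_mul (hp _) (hq _) (abs_nonneg _) ((abs_nonneg _).trans (hp _))

open Polynomial in
lemma dom_sum {p P : ℝ[X]} (hp : ∀ i, |p.coeff i| ≤ P.coeff i) (s : Finset ℕ) :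
    ∑ i ∈ s, |p.coeff i| ≤ P.eval 1 := by
  have h1 : P.eval 1 = ∑ i ∈ P.support, P.coeff i := by
    simp [eval_eq_sum, Polynomial.sum]
  rw [h1]
  have hz : ∀ i, 0 ≤ P.coeff i := fun i => (abs_nonneg _).trans (hp i)
  calc ∑ i ∈ s, |p.coeff i| ≤ ∑ i ∈ s, P.coeff i := Finset.sum_le_sum fun i _ => hp i
    _ ≤ ∑ i ∈ s ∪ P.support, P.coeff i :=
      Finset.sum_le_sum_of_subset_of_nonneg Finset.subset_union_left fun i _ _ => hz i
    _ = _ := by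
      symm
      apply Finset.sum_subset Finset.subset_union_right
      intro i _ hi; simpa using hi

lemma binom_var (M : ℕ) : ∑ j ∈ Finset.range (M + 1), (M.choose j : ℝ) * ((M : ℝ) - 2 * j) ^ 2 =
    (2 : ℝ) ^ M * (M : ℝ) := by
  have h := congrArg (Polynomial.eval (1/2 : ℝ)) (bernsteinPolynomial.variance ℝ M)
  simp only [Polynomial.eval_finsetSum, bernsteinPolynomial] at h
  simp at h
  have h2 : ∑ j ∈ Finset.range (M + 1), (M.choose j : ℝ) * ((M : ℝ) - 2 * j) ^ 2 =
     4 * 2 ^ M * ∑ x ∈ Finset.range (M + 1), ((M : ℝ) * 2⁻¹ - x) ^ 2 * (M.choose x * (2 ^ x)⁻¹ * (1 - 2⁻¹) ^ (M - x)) := by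
    rw [Finset.mul_sum]
    refine Finset.sum_congr rfl fun x hx => ?_
    have hx : x ≤ M := by simp at hx; omega
    have : (2 : ℝ) ^ M = 2 ^ x * 2 ^ (M - x) := by rw [← pow_add]; congr 1; omega
    rw [this, show (1 - 2⁻¹ : ℝ) = 2⁻¹ by norm_num, inv_pow]
    field_simp
    ring
  rw [h2, h]; ring

open Polynomial in
lemma coeff_bound (m j : ℕ) : ((m : ℝ) + 1) * ((1 + X) ^ m * (1 - X) : ℝ[X]).coeff j =
    ((m + 1).choose j : ℝ) * (((m + 1 : ℕ) : ℝ) - 2 * j) := by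
  cases j with
  | zero => simp [mul_sub, coeff_one_add_X_pow]
  | succ j =>
    rw [mul_sub, mul_one, coeff_sub, coeff_mul_X, coeff_one_add_X_pow, coeff_one_add_X_pow]
    have h1 := Nat.add_one_mul_choose_eq m j
    have h2 : (m + 1).choose (j + 1) = m.choose j + m.choose (j + 1) := Nat.choose_succ_succ m j
    rw [h2] at h1 ⊢
    have h1' : ((m : ℝ) + 1) * m.choose j = (m.choose j + m.choose (j + 1)) * (j + 1) := by
      exact_mod_cast h1
    push_cast
    linear_combination (-2) * h1'

open Polynomial in
lemma dom_basic (m : ℕ) : ∃ P : ℝ[X], (∀ i, |((1 + X) ^ m * (1 - X) : ℝ[X]).coeff i| ≤ P.coeff i) ∧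
    P.eval 1 ≤ 2 ^ (m + 1) / √((m : ℝ) + 1) := by
  refine ⟨∑ i ∈ Finset.range (m + 2), monomial i |((1 + X) ^ m * (1 - X) : ℝ[X]).coeff i|, ?_, ?_⟩
  · intro i
    simp only [finsetSum_coeff, coeff_monomial]
    rw [Finset.sum_ite_eq']
    split_ifs with h
    · exact le_rfl
    · have h' := coeff_bound m i
      rw [Nat.choose_eq_zero_of_lt (by simp at h; omega)] at h'
      have : ((m : ℝ) + 1) ≠ 0 := by positivity
      simp [this] at h'
      simp [h']
  · simp only [eval_finsetSum, eval_monomial, one_pow, mul_one]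
    set S := ∑ i ∈ Finset.range (m + 2), |((1 + X) ^ m * (1 - X) : ℝ[X]).coeff i| with hS
    have hm : (0 : ℝ) < (m : ℝ) + 1 := by positivity
    have e1 : ((m : ℝ) + 1) * S = ∑ j ∈ Finset.range (m + 1 + 1),
        √((m + 1).choose j : ℝ) * (√((m + 1).choose j : ℝ) * |(((m + 1 : ℕ) : ℝ) - 2 * j)|) := by
      rw [hS, Finset.mul_sum]
      refine Finset.sum_congr rfl fun j _ => ?_
      rw [← mul_assoc, Real.mul_self_sqrt (by positivity)]
      have := congrArg abs (coeff_bound m j)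
      rw [abs_mul, abs_of_pos hm, abs_mul, Nat.abs_cast] at this
      exact this
    have cs := Finset.sum_mul_sq_le_sq_mul_sq (Finset.range (m + 1 + 1))
      (fun j => √((m + 1).choose j : ℝ))
      (fun j => √((m + 1).choose j : ℝ) * |(((m + 1 : ℕ) : ℝ) - 2 * j)|)
    rw [← e1] at cs
    simp only [mul_pow, sq_abs] at cs
    have e2 : ∀ j, √((m + 1).choose j : ℝ) ^ 2 = (m + 1).choose j := fun j =>
      Real.sq_sqrt (by positivity)
    simp only [e2] at cs
    rw [binom_var] at cs
    have e3 : ∑ j ∈ Finset.range (m + 1 + 1), ((m + 1).choose j : ℝ) = 2 ^ (m + 1) := by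
      exact_mod_cast Nat.sum_range_choose (m + 1)
    rw [e3] at cs
    push_cast at cs
    have hS0 : 0 ≤ S := Finset.sum_nonneg fun _ _ => abs_nonneg _
    rw [le_div_iff₀ (by positivity)]
    refine (pow_le_pow_iff_left₀ (by positivity) (by positivity) two_ne_zero).1 ?_
    rw [mul_pow, Real.sq_sqrt hm.le]
    have : ((m:ℝ)+1) * (S ^ 2 * ((m:ℝ)+1)) ≤ ((m:ℝ)+1) * (2 ^ (m+1)) ^ 2 := by nlinarith [cs]
    exact le_of_mul_le_mul_left this hm

open Polynomial in
lemma TV_bound (N q R : ℕ) :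
    ∑ i ∈ Finset.range R, |((N.choose (q + i) : ℝ) - N.choose (q + i + 1)) -
      2 * ((N.choose (q + i + 1) : ℝ) - N.choose (q + i + 2)) +
      ((N.choose (q + i + 2) : ℝ) - N.choose (q + i + 3))| ≤
    8 * 2 ^ N / √((N / 3 : ℕ) + 1 : ℝ) ^ 3 := by
  obtain ⟨P, hP, hP1⟩ := dom_basic (N / 3)
  have hQ : ∀ i, |((1 + X) ^ (N % 3) : ℝ[X]).coeff i| ≤ ((1 + X) ^ (N % 3) : ℝ[X]).coeff i := by
    intro i; rw [coeff_one_add_X_pow, Nat.abs_cast]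
  have hD := dom_mul (dom_mul (dom_mul hP hP) hP) hQ
  set p : ℝ[X] := (1 + X) ^ (N / 3) * (1 - X) * ((1 + X) ^ (N / 3) * (1 - X)) *
    ((1 + X) ^ (N / 3) * (1 - X)) * (1 + X) ^ (N % 3) with hp
  have hp' : p = (1 + X) ^ N - 3 * ((1 + X) ^ N * X) + 3 * ((1 + X) ^ N * X * X)
      - (1 + X) ^ N * X * X * X := by
    have : ((1 + X) ^ N : ℝ[X]) = (1 + X) ^ (N / 3) * (1 + X) ^ (N / 3) * (1 + X) ^ (N / 3) *
        (1 + X) ^ (N % 3) := by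
      rw [← pow_add, ← pow_add, ← pow_add]; congr 1; omega
    rw [this, hp]; ring
  have hc : ∀ i, p.coeff (i + 3) = (N.choose (i + 3) : ℝ) - 3 * N.choose (i + 2) +
      3 * N.choose (i + 1) - N.choose i := by
    intro i
    have h3 : ∀ r : ℝ[X], (3 * r).coeff (i + 3) = 3 * r.coeff (i + 3) := by
      intro r; rw [show (3 : ℝ[X]) = C 3 by rfl, coeff_C_mul]
    rw [hp', coeff_sub, coeff_add, coeff_sub, h3, h3]
    rw [show i + 3 = i + 2 + 1 by rfl, coeff_mul_X, coeff_mul_X, coeff_mul_X,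
      show i + 2 = i + 1 + 1 by rfl, coeff_mul_X, coeff_mul_X, coeff_mul_X]
    simp only [coeff_one_add_X_pow]
  have hs := dom_sum hD ((Finset.range R).image fun i => q + i + 3)
  rw [Finset.sum_image (by intro a _ b _ h; simpa using h)] at hs
  have hP0 : 0 ≤ P.eval 1 := (Finset.sum_nonneg fun _ _ => abs_nonneg _).trans (dom_sum hP ∅)
  calc _ = ∑ i ∈ Finset.range R, |p.coeff (q + i + 3)| := by
        refine Finset.sum_congr rfl fun i _ => ?_
        rw [hc, ← abs_neg]; congr 1; ring
    _ ≤ _ := hs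
    _ = P.eval 1 ^ 3 * 2 ^ (N % 3) := by simp [eval_mul]; norm_num; ring
    _ ≤ (2 ^ (N / 3 + 1) / √((N / 3 : ℕ) + 1 : ℝ)) ^ 3 * 2 ^ (N % 3) := by gcongr
    _ = _ := by
      have : (2 : ℝ) ^ N = (2 ^ (N / 3)) ^ 3 * 2 ^ (N % 3) := by
        rw [← pow_mul, ← pow_add]; congr 1; omega
      rw [this, div_pow, pow_succ]; ring

lemma Mmult_eq_top (l N k₁ q : ℕ) (hl3 : 3 ≤ l) (hq : N + (k₁ * l + (l - 1)) = 2 * q) :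
    (Mmult l (k₁ * l + (l - 1)) N : ℝ) = (N.choose q : ℝ) - N.choose (q + 1) := by
  have h1 : (k₁ * l + (l - 1)) % l = l - 1 := by
    rw [Nat.mul_add_mod_self_right, Nat.mod_eq_of_lt (by omega)]
  unfold Mmult
  rw [if_pos h1, Fcoef_eq N q _ (by exact_mod_cast hq)]
  push_cast; rfl

lemma Mmult_bound (l N k₁ k₀ q : ℕ) (hk : k₀ < l - 1) (hq : N + (k₁ * l + k₀) = 2 * q) :
    |(l : ℝ) * Mmult l (k₁ * l + k₀) N -
      ((l - 1 - k₀ : ℕ) : ℝ) * ((N.choose q : ℝ) - N.choose (q + 1))| ≤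
      ((l - 1 - k₀ : ℕ) : ℝ) * l * (8 * 2 ^ N / √((N / 3 : ℕ) + 1 : ℝ) ^ 3) := by
  have h1 : (k₁ * l + k₀) % l = k₀ := by
    rw [Nat.mul_add_mod_self_right, Nat.mod_eq_of_lt (by omega)]
  have h2 : (k₁ * l + k₀) / l = k₁ := by
    rw [Nat.mul_comm, Nat.mul_add_div (by omega), Nat.div_eq_of_lt (by omega), add_zero]
  set F : ℕ → ℝ := fun i => (N.choose (q + i) : ℝ) - N.choose (q + i + 1) with hF
  obtain ⟨d, hd⟩ : ∃ d, d = l - 1 - k₀ := ⟨_, rfl⟩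
  have hM : (Mmult l (k₁ * l + k₀) N : ℝ) =
      ∑ j ∈ Finset.range (N + 1), (F (j * l) - F (j * l + d)) := by
    unfold Mmult
    rw [if_neg (by omega), h1, h2]
    push_cast
    refine Finset.sum_congr rfl fun j _ => ?_
    have hq' : (N : ℤ) + (k₁ * l + k₀) = 2 * q := by exact_mod_cast hq
    have hd' : (d : ℤ) = l - 1 - k₀ := by omega
    rw [Fcoef_eq N (q + j * l) _ (by push_cast; linear_combination hq'),
      Fcoef_eq N (q + (j * l + d)) _ (by push_cast; linear_combination hq' - 2 * hd')]
    simp only [hF]; push_cast; ring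
  have hz : F ((N + 1) * l) = 0 := by
    have : N + 1 ≤ (N + 1) * l := Nat.le_mul_of_pos_right _ (by omega)
    simp only [hF]
    rw [Nat.choose_eq_zero_of_lt (by omega), Nat.choose_eq_zero_of_lt (by omega)]; simp
  have := comb_bound F (N + 1) l d (by omega) hz
  rw [hM, ← hd]
  refine this.trans ?_
  gcongr
  exact TV_bound N q _

lemma phi_bound (δ : ℝ) (h : |δ| ≤ 1 / 2) :
    |(1 + δ) * log (1 + δ) + (1 - δ) * log (1 - δ) - δ ^ 2| ≤ 8 * |δ| ^ 3 := by
  have h1 := Real.abs_log_sub_add_sum_range_le (x := δ) (by linarith) 2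
  have h2 := Real.abs_log_sub_add_sum_range_le (x := -δ) (by rw [abs_neg]; linarith) 2
  simp only [Finset.sum_range_succ, Finset.sum_range_zero, abs_neg] at h1 h2
  norm_num at h1 h2
  have h3 : |δ| ^ 3 / (1 - |δ|) ≤ 2 * |δ| ^ 3 := by
    rw [div_le_iff₀ (by linarith)]
    nlinarith [pow_nonneg (abs_nonneg δ) 3]
  set e1 := δ + δ ^ 2 / 2 + log (1 - δ) with he1
  set e2 := -δ + δ ^ 2 / 2 + log (1 + δ) with he2
  have e : (1 + δ) * log (1 + δ) + (1 - δ) * log (1 - δ) - δ ^ 2 = (1 + δ) * e2 + (1 - δ) * e1 := by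
    rw [he1, he2]; ring
  rw [e]
  have hd := abs_le.1 h
  calc _ ≤ |(1 + δ) * e2| + |(1 - δ) * e1| := abs_add_le _ _
    _ = (1 + δ) * |e2| + (1 - δ) * |e1| := by
      rw [abs_mul, abs_mul, abs_of_nonneg (by linarith : 0 ≤ 1 + δ),
        abs_of_nonneg (by linarith : 0 ≤ 1 - δ)]
    _ ≤ (1 + δ) * (2 * |δ| ^ 3) + (1 - δ) * (2 * |δ| ^ 3) := by
      have a1 := h1.trans h3
      have a2 := h2.trans h3
      have : 0 ≤ 1 + δ := by linarith
      have : 0 ≤ 1 - δ := by linarith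
      gcongr
    _ ≤ _ := by nlinarith [pow_nonneg (abs_nonneg δ) 3]

lemma phi_tendsto (N δ : ℕ → ℝ) (c : ℝ) (hN : ∀ n, 0 ≤ N n) (hδ : Tendsto δ atTop (nhds 0))
    (hc : Tendsto (fun n => N n * δ n ^ 2) atTop (nhds c)) :
    Tendsto (fun n => N n * ((1 + δ n) * log (1 + δ n) + (1 - δ n) * log (1 - δ n))) atTop
      (nhds c) := by
  have h0 : Tendsto (fun n => 8 * (N n * δ n ^ 2 * |δ n|)) atTop (nhds 0) := by
    simpa using ((hc.mul hδ.abs).const_mul 8)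
  have h1 : Tendsto (fun n => N n * ((1 + δ n) * log (1 + δ n) + (1 - δ n) * log (1 - δ n))
      - N n * δ n ^ 2) atTop (nhds 0) := by
    refine squeeze_zero_norm' ?_ h0
    have : ∀ᶠ n in atTop, |δ n| < 1 / 2 := by
      have := hδ.abs
      rw [abs_zero] at this
      exact this.eventually_lt_const (by norm_num)
    filter_upwards [this] with n hn
    rw [← mul_sub, Real.norm_eq_abs, abs_mul, abs_of_nonneg (hN n)]
    have := mul_le_mul_of_nonneg_left (phi_bound (δ n) hn.le) (hN n)
    refine this.trans (le_of_eq ?_)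
    rw [← sq_abs (δ n)]; ring
  simpa using h1.add hc

lemma fact_eq (n : ℕ) (hn : 0 < n) : (n.factorial : ℝ) =
    Stirling.stirlingSeq n * √(2 * n) * exp (n * log n - n) := by
  have hn' : (0 : ℝ) < n := by exact_mod_cast hn
  have : exp (n * log n - n) = (n / exp 1) ^ n := by
    rw [div_pow, ← Real.exp_nat_mul, Real.exp_sub, mul_one, ← Real.rpow_natCast,
      Real.rpow_def_of_pos hn', mul_comm]
  rw [this, Stirling.stirlingSeq]
  have : √(2 * (n : ℝ)) ≠ 0 := by positivity
  field_simp

lemma llt (q m : ℕ → ℕ) (c : ℝ) (hq : Tendsto q atTop atTop) (hm : Tendsto m atTop atTop)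
    (hc : Tendsto (fun n => ((q n : ℝ) - m n) / √((q n : ℝ) + m n)) atTop (nhds c)) :
    Tendsto (fun n => ((q n + m n).choose (q n) : ℝ) * √((q n : ℝ) + m n) / 2 ^ (q n + m n))
      atTop (nhds (√(2 / π) * exp (-(c ^ 2 / 2)))) := by
  set N : ℕ → ℝ := fun n => (q n : ℝ) + m n with hN
  set δ : ℕ → ℝ := fun n => ((q n : ℝ) - m n) / N n with hδd
  have hNtop : Tendsto N atTop atTop :=
    (tendsto_natCast_atTop_atTop.comp hq).atTop_add_nonneg (fun n => by positivity)
  have hN0 : ∀ n, 0 ≤ N n := fun n => by positivity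
  have hδ : Tendsto δ atTop (nhds 0) := by
    have h1 : Tendsto (fun n => (√(N n))⁻¹) atTop (nhds 0) :=
      tendsto_inv_atTop_zero.comp (Real.tendsto_sqrt_atTop.comp hNtop)
    have := hc.mul h1
    rw [mul_zero] at this
    refine this.congr fun n => ?_
    simp only [hδd]
    rw [← div_eq_mul_inv, div_div, Real.mul_self_sqrt (hN0 n)]
  have hNδ : Tendsto (fun n => N n * δ n ^ 2) atTop (nhds (c ^ 2)) := by
    refine (hc.pow 2).congr' ?_
    filter_upwards [hNtop.eventually_gt_atTop 0] with n hn
    simp only [hδd]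
    rw [div_pow, Real.sq_sqrt (hN0 n), div_pow]
    field_simp
  have hphi := phi_tendsto N δ _ hN0 hδ hNδ
  have hexp : Tendsto (fun n => exp (-(N n * ((1 + δ n) * log (1 + δ n) +
      (1 - δ n) * log (1 - δ n)) / 2))) atTop (nhds (exp (-(c ^ 2 / 2)))) :=
    (Real.continuous_exp.tendsto _).comp ((hphi.div_const 2).neg)
  have hst := Stirling.tendsto_stirlingSeq_sqrt_pi
  have hpi : √π ≠ 0 := by positivity
  have hqm : Tendsto (fun n => q n + m n) atTop atTop :=
    hq.atTop_add_nonneg (fun n => Nat.zero_le _)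
  have hs : Tendsto (fun n => Stirling.stirlingSeq (q n + m n) /
      (Stirling.stirlingSeq (q n) * Stirling.stirlingSeq (m n))) atTop (nhds (√π / (√π * √π))) :=
    (hst.comp hqm).div ((hst.comp hq).mul (hst.comp hm)) (by positivity)
  have hr : Tendsto (fun n => √2 / √(1 - δ n ^ 2)) atTop (nhds (√2 / √(1 - 0 ^ 2))) := by
    refine tendsto_const_nhds.div ?_ (by norm_num)
    exact (Real.continuous_sqrt.tendsto _).comp (tendsto_const_nhds.sub (hδ.pow 2))
  have hall := (hs.mul hr).mul hexp
  have hlim : √π / (√π * √π) * (√2 / √(1 - 0 ^ 2)) * exp (-(c ^ 2 / 2)) =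
      √(2 / π) * exp (-(c ^ 2 / 2)) := by
    rw [Real.sqrt_div (by norm_num)]
    norm_num
    field_simp
  rw [hlim] at hall
  refine hall.congr' ?_
  filter_upwards [hq.eventually_gt_atTop 0, hm.eventually_gt_atTop 0] with n hqn hmn
  have hq' : (0 : ℝ) < q n := by exact_mod_cast hqn
  have hm' : (0 : ℝ) < m n := by exact_mod_cast hmn
  have hNn : 0 < N n := by positivity
  have e1 : 1 + δ n = 2 * q n / N n := by simp only [hδd]; field_simp; simp only [hN]; ring
  have e2 : 1 - δ n = 2 * m n / N n := by simp only [hδd]; field_simp; simp only [hN]; ring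
  have e3 : 1 - δ n ^ 2 = (2 * q n) * (2 * m n) / N n ^ 2 := by
    have : 1 - δ n ^ 2 = (1 + δ n) * (1 - δ n) := by ring
    rw [this, e1, e2]; field_simp
  have l1 : log (1 + δ n) = log 2 + log (q n) - log (N n) := by
    rw [e1, Real.log_div (by positivity) hNn.ne', Real.log_mul (by norm_num) hq'.ne']
  have l2 : log (1 - δ n) = log 2 + log (m n) - log (N n) := by
    rw [e2, Real.log_div (by positivity) hNn.ne', Real.log_mul (by norm_num) hm'.ne']
  rw [Nat.cast_add_choose, fact_eq (q n + m n) (by omega), fact_eq _ hqn, fact_eq _ hmn]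
  have c1 : ((q n + m n : ℕ) : ℝ) = N n := by push_cast; rfl
  rw [c1, l1, l2, e3, e1, e2]
  have c2 : (2 : ℝ) ^ (q n + m n) = exp (N n * log 2) := by
    rw [← Real.rpow_natCast, c1, Real.rpow_def_of_pos (by norm_num), mul_comm]
  rw [c2]
  have ex : exp (-(N n * (2 * q n / N n * (log 2 + log (q n) - log (N n)) +
      2 * m n / N n * (log 2 + log (m n) - log (N n))) / 2)) =
      exp (N n * log (N n) - N n) / (exp (q n * log (q n) - q n) * exp (m n * log (m n) - m n))
        / exp (N n * log 2) := by
    rw [← Real.exp_add, ← Real.exp_sub, ← Real.exp_sub]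
    congr 1
    field_simp
    simp only [hN]
    ring
  rw [ex]
  have sq1 : √2 / √(2 * ↑(q n) * (2 * ↑(m n)) / N n ^ 2) =
      √(2 * N n) * √(N n) / (√(2 * q n) * √(2 * m n)) := by
    rw [Real.sqrt_div (by positivity), Real.sqrt_sq hNn.le, Real.sqrt_mul (by positivity) (2 * (m n : ℝ)),
      Real.sqrt_mul (by norm_num) (N n), mul_assoc, Real.mul_self_sqrt hNn.le]
    field_simp
  rw [sq1]
  change _ = _ * √(N n) / _
  field_simp

lemma sinh_div_tendsto (t : ℕ → ℝ) (ht : Tendsto t atTop (nhds 0))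
    (htne : ∀ᶠ n in atTop, t n ≠ 0) : Tendsto (fun n => sinh (t n) / t n) atTop (nhds 1) := by
  have h := (Real.hasDerivAt_sinh 0).tendsto_slope
  rw [Real.cosh_zero] at h
  have h' : Tendsto t atTop (nhdsWithin 0 {0}ᶜ) :=
    tendsto_nhdsWithin_iff.2 ⟨ht, htne⟩
  refine (h.comp h').congr fun n => ?_
  simp [slope_def_field]

lemma cosh_tendsto (N : ℕ → ℕ) (t : ℕ → ℝ) (c : ℝ) (ht : Tendsto t atTop (nhds 0))
    (htne : ∀ᶠ n in atTop, t n ≠ 0)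
    (hc : Tendsto (fun n => (N n : ℝ) * t n ^ 2) atTop (nhds c)) :
    Tendsto (fun n => (exp (t n) + exp (-(t n))) ^ N n / 2 ^ N n) atTop (nhds (exp (c / 2))) := by
  have hsh : Tendsto (fun n => sinh (t n) / t n) atTop (nhds 1) := sinh_div_tendsto t ht htne
  have h1 : Tendsto (fun n => (N n : ℝ) * sinh (t n) ^ 2) atTop (nhds c) := by
    have := hc.mul (hsh.pow 2)
    simp only [one_pow, mul_one] at this
    refine this.congr' ?_
    filter_upwards [htne] with n hn
    field_simp
  have h2 : Tendsto (fun n => cosh (t n) ^ 2) atTop (nhds 1) := by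
    have := ((Real.continuous_cosh.tendsto 0).comp ht).pow 2
    simpa using this
  have h3 : Tendsto (fun n => (N n : ℝ) * log (cosh (t n) ^ 2)) atTop (nhds c) := by
    have hlow : Tendsto (fun n => (N n : ℝ) * sinh (t n) ^ 2 / cosh (t n) ^ 2) atTop (nhds c) := by
      have := h1.div h2 one_ne_zero
      rw [div_one] at this
      exact this
    refine tendsto_of_tendsto_of_tendsto_of_le_of_le hlow h1 ?_ ?_
    · intro n
      have hp : 0 < cosh (t n) ^ 2 := by have := Real.cosh_pos (t n); positivity
      have := Real.one_sub_inv_le_log_of_pos hp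
      have e : 1 - (cosh (t n) ^ 2)⁻¹ = sinh (t n) ^ 2 / cosh (t n) ^ 2 := by
        rw [Real.sinh_sq]; field_simp
      rw [e] at this
      have := mul_le_mul_of_nonneg_left this (Nat.cast_nonneg (α := ℝ) (N n))
      simp only [mul_div_assoc]; exact this
    · intro n
      have hp : 0 < cosh (t n) ^ 2 := by have := Real.cosh_pos (t n); positivity
      have := Real.log_le_sub_one_of_pos hp
      rw [← Real.sinh_sq] at this
      exact mul_le_mul_of_nonneg_left this (Nat.cast_nonneg (α := ℝ) (N n))
  have h4 := (Real.continuous_exp.tendsto _).comp (h3.div_const 2)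
  refine h4.congr fun n => ?_
  rw [← div_pow, ← Real.cosh_eq]
  have hp := Real.cosh_pos (t n)
  simp only [Function.comp]
  rw [Real.log_pow, ← Real.rpow_natCast, Real.rpow_def_of_pos hp]
  congr 1; push_cast; ring


lemma s_top : Tendsto (fun n : ℕ => √(2 * (n : ℝ))) atTop atTop :=
  Real.tendsto_sqrt_atTop.comp (tendsto_natCast_atTop_atTop.const_mul_atTop (by norm_num))

lemma F_tendsto (l N₀ : ℕ) (hl : 0 < l) (k q : ℕ → ℕ) (B : ℝ)
    (hk : Tendsto (fun n : ℕ => (k n : ℝ) / √(2 * n)) atTop (nhds B))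
    (hq : ∀ n, (2 * l * n + N₀) + k n = 2 * q n) :
    Tendsto (fun n : ℕ => (n : ℝ) * (((2 * l * n + N₀).choose (q n) : ℝ) -
        (2 * l * n + N₀).choose (q n + 1)) / 2 ^ (2 * l * n + N₀)) atTop
      (nhds (√(2 / π) * exp (-((B / √l) ^ 2 / 2)) * B * (1 / l) * (1 / √l))) := by
  have hl' : (0 : ℝ) < l := by exact_mod_cast hl
  have hs := s_top
  have hsinv : Tendsto (fun n : ℕ => (√(2 * (n : ℝ)))⁻¹) atTop (nhds 0) :=
    tendsto_inv_atTop_zero.comp hs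
  have hninv : Tendsto (fun n : ℕ => ((n : ℝ))⁻¹) atTop (nhds 0) :=
    tendsto_inv_atTop_zero.comp tendsto_natCast_atTop_atTop
  have hqn : Tendsto (fun n : ℕ => (q n : ℝ) / n) atTop (nhds l) := by
    have h := ((hninv.const_mul (N₀ / 2 : ℝ)).const_add (l : ℝ)).add (hk.mul hsinv)
    simp only [mul_zero, add_zero] at h
    refine h.congr' ?_
    filter_upwards [eventually_gt_atTop 0] with n hn
    have hn' : (0 : ℝ) < n := by exact_mod_cast hn
    have e : (2 * (l : ℝ) * n + N₀) + k n = 2 * q n := by exact_mod_cast hq n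
    rw [← div_eq_mul_inv ((k n : ℝ) / √(2 * (n : ℝ))), div_div, Real.mul_self_sqrt (by positivity)]
    field_simp
    linarith
  have hmn : Tendsto (fun n : ℕ => ((2 * l * n + N₀ : ℝ) - q n) / n) atTop (nhds l) := by
    have h := ((hninv.const_mul (N₀ : ℝ)).const_add (2 * l : ℝ)).sub hqn
    have e : (2 * l + N₀ * 0 - l : ℝ) = l := by ring
    rw [e] at h
    refine h.congr' ?_
    filter_upwards [eventually_gt_atTop 0] with n hn
    have hn' : (0 : ℝ) < n := by exact_mod_cast hn
    field_simp
  have hqtop : Tendsto q atTop atTop := by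
    rw [← tendsto_natCast_atTop_iff (R := ℝ)]
    refine (hqn.pos_mul_atTop hl' tendsto_natCast_atTop_atTop).congr' ?_
    filter_upwards [eventually_gt_atTop 0] with n hn
    have hn' : (0 : ℝ) < n := by exact_mod_cast hn
    field_simp
  have hm1 := hmn.pos_mul_atTop hl' tendsto_natCast_atTop_atTop
  have hle : ∀ᶠ n in atTop, q n ≤ 2 * l * n + N₀ := by
    filter_upwards [eventually_gt_atTop 0, hm1.eventually_gt_atTop 0] with n hn h
    have hn' : (0 : ℝ) < n := by exact_mod_cast hn
    have h : (0 : ℝ) < (2 * l * n + N₀ : ℝ) - q n := by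
      rwa [div_mul_cancel₀ _ hn'.ne'] at h
    have : (q n : ℝ) < ((2 * l * n + N₀ : ℕ) : ℝ) := by push_cast; linarith
    exact_mod_cast this.le
  set m : ℕ → ℕ := fun n => 2 * l * n + N₀ - q n with hm
  have hmtop : Tendsto m atTop atTop := by
    rw [← tendsto_natCast_atTop_iff (R := ℝ)]
    refine hm1.congr' ?_
    filter_upwards [eventually_gt_atTop 0, hle] with n hn h
    have hn' : (0 : ℝ) < n := by exact_mod_cast hn
    simp only [hm]
    rw [Nat.cast_sub h]
    push_cast
    field_simp
  have hsN : Tendsto (fun n : ℕ => √(2 * (n : ℝ)) / √(2 * l * n + N₀)) atTop (nhds (1 / √l)) := by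
    have h := (hninv.const_mul (N₀ / 2 : ℝ)).const_add (l : ℝ)
    simp only [mul_zero, add_zero] at h
    have h2 := (((Real.continuous_sqrt.tendsto _).comp h).inv₀ (by positivity))
    rw [one_div]
    refine h2.congr' ?_
    filter_upwards [eventually_gt_atTop 0] with n hn
    have hn' : (0 : ℝ) < n := by exact_mod_cast hn
    simp only [Function.comp]
    rw [← Real.sqrt_inv, ← Real.sqrt_div (by positivity)]
    congr 1
    field_simp
  have hc : Tendsto (fun n => ((q n : ℝ) - m n) / √((q n : ℝ) + m n)) atTop (nhds (B / √l)) := by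
    have h := hk.mul hsN
    rw [mul_one_div] at h
    refine h.congr' ?_
    filter_upwards [eventually_gt_atTop 0, hle] with n hn h
    have hn' : (0 : ℝ) < n := by exact_mod_cast hn
    have e : (2 * (l : ℝ) * n + N₀) + k n = 2 * q n := by exact_mod_cast hq n
    simp only [hm]
    rw [Nat.cast_sub h]
    push_cast
    have e1 : (q n : ℝ) - (2 * l * n + N₀ - q n) = k n := by linarith
    have e2 : (q n : ℝ) + (2 * l * n + N₀ - q n) = 2 * l * n + N₀ := by ring
    rw [e1, e2, div_mul_div_cancel₀ (by positivity)]
  have hL := llt q m _ hqtop hmtop hc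
  have hk1 : Tendsto (fun n : ℕ => ((k n : ℝ) + 1) / √(2 * n)) atTop (nhds B) := by
    have := hk.add hsinv
    rw [add_zero] at this
    refine this.congr fun n => ?_
    rw [add_div, one_div]
  have hnq : Tendsto (fun n : ℕ => (n : ℝ) / (q n + 1)) atTop (nhds (1 / l)) := by
    have := (hqn.add hninv).inv₀ (by simpa using hl'.ne')
    rw [add_zero, ← one_div] at this
    refine this.congr' ?_
    filter_upwards [eventually_gt_atTop 0] with n hn
    have hn' : (0 : ℝ) < n := by exact_mod_cast hn
    field_simp
  refine (((hL.mul hk1).mul hnq).mul hsN).congr' ?_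
  filter_upwards [eventually_gt_atTop 0, hle] with n hn h
  have hn' : (0 : ℝ) < n := by exact_mod_cast hn
  have e : (2 * (l : ℝ) * n + N₀) + k n = 2 * q n := by exact_mod_cast hq n
  have hqm : q n + m n = 2 * l * n + N₀ := by simp only [hm]; omega
  have hqm' : (q n : ℝ) + m n = 2 * l * n + N₀ := by exact_mod_cast hqm
  rw [hqm, hqm']
  have hch := Nat.choose_succ_right_eq (2 * l * n + N₀) (q n)
  have hch' : ((2 * l * n + N₀).choose (q n + 1) : ℝ) * (q n + 1) =
      (2 * l * n + N₀).choose (q n) * ((2 * l * n + N₀ : ℝ) - q n) := by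
    have := congrArg (Nat.cast (R := ℝ)) hch
    rw [Nat.cast_mul, Nat.cast_mul, Nat.cast_sub h] at this
    push_cast at this
    exact this
  have hF : ((2 * l * n + N₀).choose (q n) : ℝ) - (2 * l * n + N₀).choose (q n + 1) =
      (2 * l * n + N₀).choose (q n) * (k n + 1) / (q n + 1) := by
    rw [eq_div_iff (by positivity), sub_mul, hch']
    have : (k n : ℝ) = 2 * q n - (2 * l * n + N₀) := by linarith
    rw [this]; ring
  rw [hF]
  have : (0 : ℝ) < 2 * l * n + N₀ := by positivity
  have h1 : √(2 * l * n + N₀ : ℝ) ≠ 0 := by positivity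
  have h2 : √(2 * n : ℝ) ≠ 0 := by positivity
  field_simp

lemma M_tendsto (l N₀ k₀ : ℕ) (hl : Odd l) (hl3 : 3 ≤ l) (hk₀ : k₀ ≤ l - 1) (b : ℝ)
    (k₁ : ℕ → ℕ) (hpar : ∀ n, k₁ n % 2 = (N₀ + k₀) % 2)
    (hconv : Tendsto (fun n : ℕ => (k₁ n : ℝ) / √(2 * n)) atTop (nhds b)) :
    Tendsto (fun n : ℕ => (n : ℝ) * Mmult l (k₁ n * l + k₀) (2 * l * n + N₀) /
        2 ^ (2 * l * n + N₀)) atTop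
      (nhds ((if k₀ = l - 1 then 1 else ((l : ℝ) - 1 - k₀) / l) *
        (√(2 / π) * exp (-((b * l / √l) ^ 2 / 2)) * (b * l) * (1 / l) * (1 / √l)))) := by
  have hsinv : Tendsto (fun n : ℕ => (√(2 * (n : ℝ)))⁻¹) atTop (nhds 0) :=
    tendsto_inv_atTop_zero.comp s_top
  have hk : Tendsto (fun n : ℕ => ((k₁ n * l + k₀ : ℕ) : ℝ) / √(2 * n)) atTop (nhds (b * l)) := by
    have := (hconv.mul_const (l : ℝ)).add (hsinv.const_mul (k₀ : ℝ))
    rw [mul_zero, add_zero] at this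
    refine this.congr fun n => ?_
    push_cast; ring
  have hqe : ∀ n, ∃ q, (2 * l * n + N₀) + (k₁ n * l + k₀) = 2 * q := by
    intro n
    obtain ⟨a, rfl⟩ := hl
    have h := hpar n
    have : (k₁ n + N₀ + k₀) % 2 = 0 := by omega
    obtain ⟨c, hc⟩ := Nat.dvd_of_mod_eq_zero this
    refine ⟨(2 * a + 1) * n + k₁ n * a + c, ?_⟩
    linarith
  choose q hq using hqe
  have hF := F_tendsto l N₀ (by omega) (fun n => k₁ n * l + k₀) q (b * l) hk hq
  set α := √(2 / π) * exp (-((b * l / √l) ^ 2 / 2)) * (b * l) * (1 / l) * (1 / √l) with hα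
  split_ifs with h
  · subst h
    rw [one_mul]
    refine hF.congr fun n => ?_
    rw [Mmult_eq_top l _ _ (q n) hl3 (hq n)]
  · obtain ⟨d, hd⟩ : ∃ d, d = l - 1 - k₀ := ⟨_, rfl⟩
    have hd' : (d : ℝ) = (l : ℝ) - 1 - k₀ := by
      have : (l : ℝ) = d + 1 + k₀ := by
        have : l = d + 1 + k₀ := by omega
        exact_mod_cast this
      rw [this]; ring
    have hl' : (0 : ℝ) < l := by have : 0 < l := by omega
                                 exact_mod_cast this
    rw [← hd']
    have h0 : Tendsto (fun n : ℕ => (d * l * 8 : ℝ) * (√(n : ℝ))⁻¹) atTop (nhds 0) := by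
      have := tendsto_inv_atTop_zero.comp (Real.tendsto_sqrt_atTop.comp
        (tendsto_natCast_atTop_atTop (R := ℝ)))
      simpa using this.const_mul (d * l * 8 : ℝ)
    have hdiff : Tendsto (fun n : ℕ => (l : ℝ) * ((n : ℝ) * Mmult l (k₁ n * l + k₀) (2 * l * n + N₀) /
        2 ^ (2 * l * n + N₀)) - d * ((n : ℝ) * (((2 * l * n + N₀).choose (q n) : ℝ) -
        (2 * l * n + N₀).choose (q n + 1)) / 2 ^ (2 * l * n + N₀))) atTop (nhds 0) := by
      refine squeeze_zero_norm' ?_ h0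
      filter_upwards [eventually_gt_atTop 0] with n hn
      have hn' : (0 : ℝ) < n := by exact_mod_cast hn
      have hb := Mmult_bound l (2 * l * n + N₀) (k₁ n) k₀ (q n) (by omega) (hq n)
      rw [← hd] at hb
      set N := 2 * l * n + N₀ with hN
      have e : (l : ℝ) * ((n : ℝ) * Mmult l (k₁ n * l + k₀) N / 2 ^ N) - d * ((n : ℝ) *
          ((N.choose (q n) : ℝ) - N.choose (q n + 1)) / 2 ^ N) = n / 2 ^ N *
          ((l : ℝ) * Mmult l (k₁ n * l + k₀) N - d * ((N.choose (q n) : ℝ) - N.choose (q n + 1))) := by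
        ring
      rw [e, Real.norm_eq_abs, abs_mul, abs_of_nonneg (by positivity)]
      have hNn : (n : ℝ) ≤ (N / 3 : ℕ) + 1 := by
        have : n ≤ N / 3 + 1 := by
          have : 3 * n ≤ N := by rw [hN]; nlinarith
          omega
        exact_mod_cast this
      calc _ ≤ (n : ℝ) / 2 ^ N * (d * l * (8 * 2 ^ N / √((N / 3 : ℕ) + 1 : ℝ) ^ 3)) := by gcongr
        _ ≤ (n : ℝ) / 2 ^ N * (d * l * (8 * 2 ^ N / √(n : ℝ) ^ 3)) := by gcongr
        _ = _ := by
          have h3 : √(n : ℝ) ^ 3 = n * √(n : ℝ) := by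
            rw [pow_succ, Real.sq_sqrt hn'.le]
          rw [h3]; field_simp
    have := (hdiff.add (hF.const_mul (d : ℝ))).div_const (l : ℝ)
    rw [zero_add, mul_div_right_comm] at this
    refine this.congr fun n => ?_
    rw [sub_add_cancel, mul_div_cancel_left₀ _ hl'.ne']

lemma chT_tendsto (l k₀ : ℕ) (hl3 : 3 ≤ l) (hk₀ : k₀ ≤ l - 1) (u b : ℝ) (hu : 0 < u) (hb : 0 < b)
    (k₁ : ℕ → ℕ)
    (hconv : Tendsto (fun n : ℕ => (k₁ n : ℝ) / √(2 * n)) atTop (nhds b)) :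
    Tendsto (fun n : ℕ => chT l (k₁ n * l + k₀) (exp (u / √(2 * n))) / √(2 * n)) atTop
      (nhds ((if k₀ = l - 1 then 1 else 2) * (exp (l * b * u) - exp (-(l * b * u))) / (2 * u))) := by
  have hsinv : Tendsto (fun n : ℕ => (√(2 * (n : ℝ)))⁻¹) atTop (nhds 0) :=
    tendsto_inv_atTop_zero.comp s_top
  have ht : Tendsto (fun n : ℕ => u / √(2 * (n : ℝ))) atTop (nhds 0) := by
    simpa [div_eq_mul_inv] using hsinv.const_mul u
  have htne : ∀ᶠ n : ℕ in atTop, u / √(2 * (n : ℝ)) ≠ 0 := by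
    filter_upwards [eventually_gt_atTop 0] with n hn
    have hn' : (0 : ℝ) < n := by exact_mod_cast hn
    positivity
  have hk1 : ∀ᶠ n in atTop, k₁ n ≠ 0 := by
    filter_upwards [hconv.eventually (lt_mem_nhds hb)] with n hn h
    simp [h] at hn
  have hsh := sinh_div_tendsto _ ht htne
  have hden : Tendsto (fun n : ℕ => (exp (u / √(2 * n)) - (exp (u / √(2 * n)))⁻¹) * √(2 * n)) atTop
      (nhds (2 * u)) := by
    have := hsh.mul_const (2 * u)
    rw [one_mul] at this
    refine this.congr' ?_
    filter_upwards [eventually_gt_atTop 0] with n hn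
    have hn' : (0 : ℝ) < n := by exact_mod_cast hn
    rw [Real.sinh_eq, ← Real.exp_neg]
    have : √(2 * n : ℝ) ≠ 0 := by positivity
    field_simp
  have hmod : ∀ n, (k₁ n * l + k₀) % l = k₀ := fun n => by
    rw [Nat.mul_add_mod_self_right, Nat.mod_eq_of_lt (by omega)]
  have hdiv : ∀ n, (k₁ n * l + k₀) / l = k₁ n := fun n => by
    rw [Nat.mul_comm, Nat.mul_add_div (by omega), Nat.div_eq_of_lt (by omega), add_zero]
  have hE : ∀ c : ℝ, Tendsto (fun n : ℕ => ((k₁ n : ℝ) + c) * l * (u / √(2 * n))) atTop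
      (nhds (l * b * u)) := by
    intro c
    have := (hconv.add (hsinv.const_mul c)).mul_const (l * u : ℝ)
    have e : (b + c * 0) * (l * u) = l * b * u := by ring
    rw [e] at this
    refine this.congr fun n => ?_
    ring
  have hX : ∀ c : ℝ, Tendsto (fun n : ℕ => exp (((k₁ n : ℝ) + c) * l * (u / √(2 * n))) -
      exp (-(((k₁ n : ℝ) + c) * l * (u / √(2 * n))))) atTop
      (nhds (exp (l * b * u) - exp (-(l * b * u)))) := fun c =>
    ((Real.continuous_exp.tendsto _).comp (hE c)).sub
      ((Real.continuous_exp.tendsto _).comp (hE c).neg)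
  split_ifs with h
  · rw [one_mul]
    refine ((hX 1).div hden (by positivity)).congr' ?_
    filter_upwards [hk1] with n hn
    unfold chT
    rw [hmod, hdiv, if_neg hn, if_pos h, exp_zp, exp_zp, div_div]
    push_cast
    simp [neg_mul]
  · have hco : Tendsto (fun n : ℕ => exp (((k₀ : ℝ) + 1) * (u / √(2 * n))) +
        exp (-(((k₀ : ℝ) + 1) * (u / √(2 * n))))) atTop (nhds 2) := by
      have h1 := ht.const_mul ((k₀ : ℝ) + 1)
      have := ((Real.continuous_exp.tendsto _).comp h1).add
        ((Real.continuous_exp.tendsto _).comp h1.neg)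
      have e : exp (((k₀ : ℝ) + 1) * 0) + exp (-(((k₀ : ℝ) + 1) * 0)) = 2 := by
        simp; norm_num
      rw [e] at this
      exact this
    refine ((hco.mul (hX 0)).div hden (by positivity)).congr' ?_
    filter_upwards [hk1] with n hn
    unfold chT
    rw [hmod, hdiv, if_neg hn, if_neg h, exp_zp, exp_zp, exp_zp, exp_zp, div_div]
    push_cast
    simp only [neg_mul, add_zero, Pi.div_apply]


theorem stmt17 (l N₀ k₀ : ℕ) (hl : Odd l) (hl3 : 3 ≤ l)
    (hN₀ : N₀ ≤ 2 * l - 1) (hk₀ : k₀ ≤ l - 1) (u b : ℝ) (hu : 0 < u) (hb : 0 < b)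
    (k₁ : ℕ → ℕ) (hpar : ∀ n, k₁ n % 2 = (N₀ + k₀) % 2)
    (hconv : Tendsto (fun n : ℕ => (k₁ n : ℝ) / Real.sqrt (2 * n)) atTop (nhds b)) :
    Tendsto (fun n : ℕ => Real.sqrt (n / 2) *
        ((Mmult l (k₁ n * l + k₀) (2 * l * n + N₀) : ℝ) *
          chT l (k₁ n * l + k₀) (Real.exp (u / Real.sqrt (2 * n))) /
          (Real.exp (u / Real.sqrt (2 * n)) + Real.exp (-(u / Real.sqrt (2 * n)))) ^
            (2 * l * n + N₀)))
      atTop (nhds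
        ((if k₀ = l - 1 then 1 / (l : ℝ) else 2 * ((l : ℝ) - 1 - k₀) / (l : ℝ) ^ 2) *
          ((b / u) * Real.sqrt ((l : ℝ) / (2 * π)) *
            (Real.exp ((l : ℝ) * b * u) - Real.exp (-((l : ℝ) * b * u))) *
            Real.exp (-(u ^ 2 * l / 2)) * Real.exp (-(b ^ 2 * l / 2))))) := by
  have hl0 : 0 < l := by omega
  have hl' : (0 : ℝ) < l := by exact_mod_cast hl0
  have hM := M_tendsto l N₀ k₀ hl hl3 hk₀ b k₁ hpar hconv
  have hC := chT_tendsto l k₀ hl3 hk₀ u b hu hb k₁ hconv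
  have hsinv : Tendsto (fun n : ℕ => (√(2 * (n : ℝ)))⁻¹) atTop (nhds 0) :=
    tendsto_inv_atTop_zero.comp s_top
  have hninv : Tendsto (fun n : ℕ => ((n : ℝ))⁻¹) atTop (nhds 0) :=
    tendsto_inv_atTop_zero.comp tendsto_natCast_atTop_atTop
  have ht : Tendsto (fun n : ℕ => u / √(2 * (n : ℝ))) atTop (nhds 0) := by
    simpa [div_eq_mul_inv] using hsinv.const_mul u
  have htne : ∀ᶠ n : ℕ in atTop, u / √(2 * (n : ℝ)) ≠ 0 := by
    filter_upwards [eventually_gt_atTop 0] with n hn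
    have hn' : (0 : ℝ) < n := by exact_mod_cast hn
    positivity
  have hNt : Tendsto (fun n : ℕ => ((2 * l * n + N₀ : ℕ) : ℝ) * (u / √(2 * (n : ℝ))) ^ 2) atTop
      (nhds (u ^ 2 * l)) := by
    have h := ((hninv.const_mul (N₀ / 2 : ℝ)).const_add (l : ℝ)).const_mul (u ^ 2)
    simp only [mul_zero, add_zero] at h
    refine h.congr' ?_
    filter_upwards [eventually_gt_atTop 0] with n hn
    have hn' : (0 : ℝ) < n := by exact_mod_cast hn
    rw [div_pow, Real.sq_sqrt (by positivity)]
    push_cast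
    field_simp
  have hD := cosh_tendsto (fun n => 2 * l * n + N₀) _ _ ht htne hNt
  have hall := (hM.mul hC).div hD (Real.exp_pos _).ne'
  have hlim : (if k₀ = l - 1 then 1 / (l : ℝ) else 2 * ((l : ℝ) - 1 - k₀) / (l : ℝ) ^ 2) *
          ((b / u) * Real.sqrt ((l : ℝ) / (2 * π)) *
            (Real.exp ((l : ℝ) * b * u) - Real.exp (-((l : ℝ) * b * u))) *
            Real.exp (-(u ^ 2 * l / 2)) * Real.exp (-(b ^ 2 * l / 2))) =
      (if k₀ = l - 1 then 1 else ((l : ℝ) - 1 - k₀) / l) *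
        (√(2 / π) * exp (-((b * l / √l) ^ 2 / 2)) * (b * l) * (1 / l) * (1 / √l)) *
      ((if k₀ = l - 1 then 1 else 2) * (exp (l * b * u) - exp (-(l * b * u))) / (2 * u)) /
      exp (u ^ 2 * l / 2) := by
    have e1 : (b * l / √l) ^ 2 = b ^ 2 * l := by
      rw [div_pow, Real.sq_sqrt hl'.le]; field_simp
    have e2 : √(2 / π) * (1 / √l) = 2 * ((1 / l) * √((l : ℝ) / (2 * π))) := by
      rw [Real.sqrt_div (by norm_num), Real.sqrt_div hl'.le, Real.sqrt_mul (by norm_num)]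
      have hpi : √π ≠ 0 := by have := Real.pi_pos; positivity
      have h2 : √2 * √2 = (2 : ℝ) := Real.mul_self_sqrt (by norm_num)
      have h3 : √(l : ℝ) * √l = l := Real.mul_self_sqrt hl'.le
      have h4 : √(l : ℝ) ≠ 0 := by positivity
      field_simp
      nlinarith
    rw [e1, Real.exp_neg (u ^ 2 * l / 2)]
    set E := exp (l * b * u) - exp (-(l * b * u)) with hE
    set Z := exp (-(b ^ 2 * l / 2)) with hZ
    have e3 : √(2 / π) * Z * (b * l) * (1 / l) * (1 / √l) =
        Z * b * (2 * ((1 / l) * √((l : ℝ) / (2 * π)))) := by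
      rw [← e2]; field_simp
    rw [e3]
    split_ifs <;> field_simp
  rw [hlim]
  refine hall.congr' ?_
  filter_upwards [eventually_gt_atTop 0] with n hn
  have hn' : (0 : ℝ) < n := by exact_mod_cast hn
  have e : √((n : ℝ) / 2) = n / √(2 * n) := by
    rw [eq_div_iff (by positivity), ← Real.sqrt_mul (by positivity)]
    rw [show (n : ℝ) / 2 * (2 * n) = n ^ 2 by ring, Real.sqrt_sq hn'.le]
  rw [e]
  have hs : √(2 * n : ℝ) ≠ 0 := by positivity
  have hD0 : exp (u / √(2 * n)) + exp (-(u / √(2 * n))) ≠ 0 := by positivity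
  simp only [Pi.div_apply]
  field_simp
end
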